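/- Fix θ₀ = (σ₀,δ₀,α₀) with σ₀ > 0, δ₀ > 0 and α₀ ∈ (0,2). There exist C > 0, p > 0 and N ∈ ℕ such that for all n ≥ N and all y ∈ ℝ: (i) |∂²_{σσ} ln p_{1/n}(y, θ₀)| ≤ C (ln n)^p; and (ii) for every pair (a,b) ∈ {σ,δ,α}² with (a,b) ≠ (σ,σ), |∂²_{ab} ln p_{1/n}(y, θ₀)| ≤ C (ln n)^p · w_n(θ₀)^{α₀} ψ_{α₀}^{(2)}(√n y/σ₀) / ( φ(√n y/σ₀) + w_n(θ₀)^{α₀} ψ_{α₀}^{(0)}(√n y/σ₀) ), where ∂²_{ab} denotes the second partial derivative in the parameter coordinates a, b of θ = (σ,δ,α). -/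

import Mathlib

open MeasureTheory Filter Set Topology Matrix

noncomputable section

namespace LevyLAN

/-- Standard Gaussian density `φ`. -/
def gauss (y : ℝ) : ℝ := (Real.sqrt (2 * Real.pi))⁻¹ * Real.exp (-(y ^ 2) / 2)

/-- Symmetric `α`-stable density `φ_α`, defined by Fourier inversion. -/
def stableDensity (α z : ℝ) : ℝ :=
  (2 * Real.pi)⁻¹ * ∫ u : ℝ, Real.cos (z * u) * Real.exp (-(|u| ^ α))

/-- `∂_α φ_α`. -/
def stableDensityDalpha (α z : ℝ) : ℝ :=
  -(2 * Real.pi)⁻¹ * ∫ u : ℝ, Real.cos (z * u) * |u| ^ α * Real.log |u| * Real.exp (-(|u| ^ α))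

/-- The operator `(D f) y = (y * f y)' = f y + y * f' y`. -/
def Dop (f : ℝ → ℝ) (y : ℝ) : ℝ := f y + y * deriv f y

/-- `f_α(y, w)`. -/
def fFun (α y w : ℝ) : ℝ := ∫ z : ℝ, gauss (y - w * z) * stableDensity α z

/-- `g_α(y, w)`. -/
def gFun (α y w : ℝ) : ℝ := ∫ z : ℝ, Dop gauss (y - w * z) * stableDensity α z

/-- `h_α(y, w)`. -/
def hFun (α y w : ℝ) : ℝ := ∫ z : ℝ, gauss (y - w * z) * Dop (stableDensity α) z

/-- `k_α(y, w)`. -/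
def kFun (α y w : ℝ) : ℝ := ∫ z : ℝ, gauss (y - w * z) * stableDensityDalpha α z

/-- `c_α`. -/
def cAlpha (α : ℝ) : ℝ :=
  if α = 1 then 1 / Real.pi
  else -(α * (α - 1)) / (2 * Real.Gamma (2 - α) * Real.cos (Real.pi * α / 2))

/-- `w_n(θ) = n^{1/2 - 1/α} δ / σ`. -/
def wn (n : ℕ) (σ δ α : ℝ) : ℝ := (n : ℝ) ^ ((1 : ℝ) / 2 - 1 / α) * δ / σ

/-- `l_α(y, w)` (it depends on `n`). -/
def lFun (n : ℕ) (α y w : ℝ) : ℝ :=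
  ((Real.log n - Real.log (Real.log n)) / (2 * α) - Real.log n / α ^ 2) * hFun α y w
    + kFun α y w

def kappa0 (σ δ α : ℝ) : ℝ := 2 * cAlpha α / (α * (2 - α) ^ (α / 2)) * (δ / σ) ^ α

def kappa1 (σ δ α : ℝ) : ℝ :=
  Real.log (δ / σ) + deriv cAlpha α / cAlpha α - Real.log (2 - α) / 2 - 1 / α

/-- The density `p_{1/n}(y, θ)`, with parameter `θ = (σ, δ, α) : Fin 3 → ℝ`. -/
def pdens (n : ℕ) (θ : Fin 3 → ℝ) (y : ℝ) : ℝ :=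
  Real.sqrt n / θ 0 * fFun (θ 2) (Real.sqrt n * y / θ 0) (wn n (θ 0) (θ 1) (θ 2))

/-- The log-likelihood `ln L_n(θ)`. -/
def logLik (n : ℕ) (θ : Fin 3 → ℝ) (x : Fin n → ℝ) : ℝ :=
  ∑ i, Real.log (pdens n θ (x i))

/-- Partial derivative in the `j`-th parameter coordinate. -/
def pderiv (j : Fin 3) (F : (Fin 3 → ℝ) → ℝ) (θ : Fin 3 → ℝ) : ℝ :=
  deriv (fun t => F (Function.update θ j t)) (θ j)

/-- The score `G_n(θ) = ∇_θ ln L_n(θ)`. -/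
def scoreVec (n : ℕ) (θ : Fin 3 → ℝ) (x : Fin n → ℝ) : Fin 3 → ℝ :=
  fun j => pderiv j (fun θ' => logLik n θ' x) θ

/-- The Hessian matrix `J_n(θ)` of the log-likelihood. -/
def hessMat (n : ℕ) (θ : Fin 3 → ℝ) (x : Fin n → ℝ) : Matrix (Fin 3) (Fin 3) ℝ :=
  Matrix.of fun i j => pderiv i (fun θ' => pderiv j (fun θ'' => logLik n θ'' x) θ') θ

def rate (n : ℕ) (α : ℝ) : ℝ := Real.log n ^ (α / 4) / (n : ℝ) ^ (α / 4)

/-- The rate matrix `u_n(θ)`. -/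
def un (n : ℕ) (θ : Fin 3 → ℝ) : Matrix (Fin 3) (Fin 3) ℝ :=
  !![1 / Real.sqrt n, 0, 0;
     0, rate n (θ 2), -(rate n (θ 2) * (θ 1 / (2 * θ 2)) * (Real.log n - Real.log (Real.log n)));
     0, 0, rate n (θ 2)]

/-- The information matrix `I(θ)`. -/
def Imat (θ : Fin 3 → ℝ) : Matrix (Fin 3) (Fin 3) ℝ :=
  !![2 / θ 0 ^ 2, 0, 0;
     0, θ 2 ^ 2 / θ 1 ^ 2 * kappa0 (θ 0) (θ 1) (θ 2),
        θ 2 / θ 1 * kappa0 (θ 0) (θ 1) (θ 2) * kappa1 (θ 0) (θ 1) (θ 2);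
     0, θ 2 / θ 1 * kappa0 (θ 0) (θ 1) (θ 2) * kappa1 (θ 0) (θ 1) (θ 2),
        kappa0 (θ 0) (θ 1) (θ 2) * (kappa1 (θ 0) (θ 1) (θ 2) ^ 2 + 1 / θ 2 ^ 2)]

/-- `ℙ_n`, the `n`-fold product of the law with Lebesgue density `p_{1/n}(·, θ)`. -/
def Pn (n : ℕ) (θ : Fin 3 → ℝ) : Measure (Fin n → ℝ) :=
  Measure.pi fun _ => MeasureTheory.volume.withDensity fun y => ENNReal.ofReal (pdens n θ y)

/-- The standard Gaussian measure on `ℝ³`. -/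
def stdGauss3 : Measure (Fin 3 → ℝ) :=
  Measure.pi fun _ => ProbabilityTheory.gaussianReal 0 1

/-- Euclidean (Frobenius) norm of a real 3×3 matrix. -/
def frobNorm (M : Matrix (Fin 3) (Fin 3) ℝ) : ℝ := Real.sqrt (∑ i, ∑ j, M i j ^ 2)

/-- Euclidean norm of a vector of `ℝ³`. -/
def vecNorm (v : Fin 3 → ℝ) : ℝ := Real.sqrt (∑ j, v j ^ 2)

/-- The admissible families of functions `ψ_α^{(p)}`. -/
structure IsPsiFamily (ψ : ℝ → ℕ → ℝ → ℝ) : Prop where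
  contDiff : ∀ α ∈ Set.Ioo (0 : ℝ) 2, ∀ p : ℕ, ContDiff ℝ 2 (ψ α p)
  pos : ∀ α ∈ Set.Ioo (0 : ℝ) 2, ∀ p : ℕ, ∀ y : ℝ, 0 < ψ α p y
  even : ∀ α ∈ Set.Ioo (0 : ℝ) 2, ∀ p : ℕ, ∀ y : ℝ, ψ α p (-y) = ψ α p y
  eq_one : ∀ α ∈ Set.Ioo (0 : ℝ) 2, ∀ p : ℕ, ∀ y : ℝ, |y| ≤ 1 → ψ α p y = 1
  eq_tail : ∀ α ∈ Set.Ioo (0 : ℝ) 2, ∀ p : ℕ, ∀ y : ℝ, 3 ≤ |y| →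
    ψ α p y = Real.log |y| ^ p / |y| ^ (α + 1)
  unifBound : ∀ K : Set ℝ, K ⊆ Set.Ioo (0 : ℝ) 2 → IsCompact K → ∀ p : ℕ,
    ∃ c > (0 : ℝ), ∃ C : ℝ, ∀ α ∈ K, ∀ y : ℝ, 1 ≤ |y| → |y| ≤ 3 →
      c ≤ ψ α p y ∧ ψ α p y ≤ C

/-- `𝓘_α^{(k,l)}`. -/
def Ical (ψ : ℝ → ℕ → ℝ → ℝ) (α : ℝ) (k l : ℕ) (y : ℝ) : ℝ :=
  ∫ z in {z : ℝ | 1 < |z|}, Dop^[k] gauss (y - z) * ψ α l z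

/-- `f_α^{(k,l,m)}`. -/
def fklm (α : ℝ) (k l m : ℕ) (y w : ℝ) : ℝ :=
  ∫ z : ℝ, Dop^[k] gauss (y - w * z)
    * Dop^[l] (fun z' => iteratedDeriv m (fun a => stableDensity a z') α) z

def Gamman (n : ℕ) (α : ℝ) : ℝ := Real.sqrt ((1 - α / 2) * Real.log n)

def Mn (n : ℕ) (α : ℝ) : ℝ := Real.sqrt ((2 - α) * Real.log n)

def Kconst (σ δ α : ℝ) : ℝ := deriv cAlpha α + cAlpha α * Real.log (δ / σ)
/-- The basic symbol. -/
def Tf (β : ℝ) (k : ℕ) (a e α u : ℝ) : ℝ :=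
  u ^ β * Real.log u ^ k * Real.exp (-a * u ^ 2 - e * u ^ α)

/-- Cosine transform of the basic symbol. -/
def Bf (x β : ℝ) (k : ℕ) (a e α : ℝ) : ℝ :=
  ∫ u in Ioi (0 : ℝ), Real.cos (x * u) * Tf β k a e α u

lemma abs_log_pow_le {s u : ℝ} (hs : 0 < s) (hu : 0 < u) (k : ℕ) :
    |Real.log u| ^ k ≤ (1 / s) ^ k * (u ^ (s * k) + u ^ (-(s * k))) := by
  have key : ∀ v : ℝ, 1 ≤ v → |Real.log v| ^ k ≤ (1 / s) ^ k * v ^ (s * k) := by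
    intro v hv
    have h1 : |Real.log v| ≤ (1 / s) * v ^ s := by
      rw [abs_of_nonneg (Real.log_nonneg hv)]
      have := Real.log_le_rpow_div (x := v) (by linarith) hs
      calc _ ≤ _ := this
        _ = _ := by ring
    calc |Real.log v| ^ k ≤ ((1 / s) * v ^ s) ^ k := pow_le_pow_left₀ (abs_nonneg _) h1 k
      _ = _ := by rw [mul_pow, Real.rpow_mul_natCast (by linarith)]
  have hp : 0 < (1 / s) ^ k := by positivity
  rcases le_total 1 u with h | h
  · have := key u h
    have h2 : 0 < u ^ (-(s * k)) := Real.rpow_pos_of_pos hu _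
    nlinarith
  · have := key u⁻¹ ((one_le_inv₀ hu).2 h)
    rw [Real.log_inv, abs_neg, Real.inv_rpow hu.le, ← Real.rpow_neg hu.le] at this
    have h2 : 0 < u ^ ((s * k)) := Real.rpow_pos_of_pos hu _
    nlinarith

lemma measurable_Tf (β : ℝ) (k : ℕ) (a e α : ℝ) : Measurable (Tf β k a e α) := by
  unfold Tf
  fun_prop

lemma integrableOn_dom {β c : ℝ} (hβ : -1 < β) (hc : 0 < c) (k : ℕ) :
    IntegrableOn (fun u : ℝ => u ^ β * |Real.log u| ^ k * Real.exp (-c * u ^ 2)) (Ioi 0) := by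
  set s : ℝ := (β + 1) / (2 * (k + 1)) with hs
  have hs0 : 0 < s := by
    have : 0 < β + 1 := by linarith
    positivity
  have hsk : s * k < β + 1 := by
    rw [hs, div_mul_eq_mul_div, div_lt_iff₀ (by positivity)]
    have : (0:ℝ) ≤ k := by positivity
    nlinarith
  have i1 := integrableOn_rpow_mul_exp_neg_mul_sq hc (s := β + s * k) (by
    have : 0 ≤ s * k := by positivity
    linarith)
  have i2 := integrableOn_rpow_mul_exp_neg_mul_sq hc (s := β + -(s * k)) (by linarith)
  refine Integrable.mono' ((i1.add i2).const_mul ((1 / s) ^ k)) (by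
    apply Measurable.aestronglyMeasurable; fun_prop) ?_
  refine (ae_restrict_mem measurableSet_Ioi).mono ?_
  intro u hu
  have hu : 0 < u := hu
  have h := abs_log_pow_le hs0 hu k
  rw [Real.norm_of_nonneg (by positivity)]
  simp only [Pi.add_apply]
  rw [Real.rpow_add hu, Real.rpow_add hu]
  calc u ^ β * |Real.log u| ^ k * Real.exp (-c * u ^ 2)
      ≤ u ^ β * ((1 / s) ^ k * (u ^ (s * k) + u ^ (-(s * k)))) * Real.exp (-c * u ^ 2) := by gcongr
    _ = _ := by ring

lemma rpow_le_one_add_sq {α u : ℝ} (hu : 0 < u) (h0 : 0 ≤ α) (h2 : α ≤ 2) : u ^ α ≤ 1 + u ^ 2 := by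
  rcases le_total 1 u with h | h
  · have := Real.rpow_le_rpow_of_exponent_le h h2
    rw [Real.rpow_two] at this
    linarith
  · have := Real.rpow_le_one hu.le h h0
    nlinarith [sq_nonneg u]

lemma rpow_le_add {β β0 β1 u : ℝ} (hu : 0 < u) (h0 : β0 ≤ β) (h1 : β ≤ β1) :
    u ^ β ≤ u ^ β0 + u ^ β1 := by
  have := Real.rpow_pos_of_pos hu β0
  have := Real.rpow_pos_of_pos hu β1
  rcases le_total 1 u with h | h
  · have := Real.rpow_le_rpow_of_exponent_le h h1
    linarith
  · have := Real.rpow_le_rpow_of_exponent_ge hu h h0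
    linarith

/-- the dominating function -/
def domf (β0 β1 : ℝ) (k : ℕ) (a0 u : ℝ) : ℝ :=
  Real.exp (a0 / 2) * (u ^ β0 * |Real.log u| ^ k * Real.exp (-(a0 / 2) * u ^ 2)
    + u ^ β1 * |Real.log u| ^ k * Real.exp (-(a0 / 2) * u ^ 2))

lemma integrableOn_domf {β0 β1 a0 : ℝ} (h0 : -1 < β0) (h1 : -1 < β1) (ha : 0 < a0) (k : ℕ) :
    IntegrableOn (domf β0 β1 k a0) (Ioi 0) :=
  ((integrableOn_dom h0 (half_pos ha) k).add
    (integrableOn_dom h1 (half_pos ha) k)).const_mul _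

lemma abs_Tf_le {β β0 β1 a a0 e α u : ℝ} (k : ℕ) (hu : 0 < u) (ha0 : 0 < a0) (ha : a0 ≤ a)
    (he : -(a0 / 2) ≤ e) (hα0 : 0 ≤ α) (hα2 : α ≤ 2) (h0 : β0 ≤ β) (h1 : β ≤ β1) :
    |Tf β k a e α u| ≤ domf β0 β1 k a0 u := by
  have e1 : Real.exp (-a * u ^ 2 - e * u ^ α) ≤ Real.exp (a0 / 2) * Real.exp (-(a0 / 2) * u ^ 2) := by
    rw [← Real.exp_add, Real.exp_le_exp]
    have h3 := rpow_le_one_add_sq hu hα0 hα2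
    have h4 : 0 < u ^ α := Real.rpow_pos_of_pos hu α
    nlinarith [sq_nonneg u, mul_nonneg (sub_nonneg.2 ha) (sq_nonneg u)]
  have e2 := rpow_le_add hu h0 h1
  unfold Tf domf
  rw [abs_mul, abs_mul, abs_pow, abs_of_pos (Real.rpow_pos_of_pos hu β), abs_of_pos (Real.exp_pos _)]
  calc _ ≤ (u ^ β0 + u ^ β1) * |Real.log u| ^ k *
        (Real.exp (a0 / 2) * Real.exp (-(a0 / 2) * u ^ 2)) := by gcongr
    _ = _ := by ring

lemma integrableOn_Tf {β a e α : ℝ} (k : ℕ) (hβ : -1 < β) (ha : 0 < a)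
    (he : -(a / 2) ≤ e) (hα0 : 0 ≤ α) (hα2 : α ≤ 2) :
    IntegrableOn (Tf β k a e α) (Ioi 0) := by
  refine Integrable.mono' (integrableOn_domf hβ hβ ha k)
    (measurable_Tf _ _ _ _ _).aestronglyMeasurable ?_
  refine (ae_restrict_mem measurableSet_Ioi).mono ?_
  intro u hu
  exact abs_Tf_le k hu ha le_rfl he hα0 hα2 le_rfl le_rfl

lemma integrableOn_cos_mul {f : ℝ → ℝ} {s : Set ℝ} (hf : IntegrableOn f s) (x φ : ℝ) :
    IntegrableOn (fun u => Real.cos (x * u + φ) * f u) s := by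
  refine Integrable.bdd_mul (c := 1) hf (by
    apply Measurable.aestronglyMeasurable; fun_prop) ?_
  exact Eventually.of_forall fun u => by
    rw [Real.norm_eq_abs]; exact Real.abs_cos_le_one _

lemma integrableOn_cosTf {β a e α : ℝ} (x : ℝ) (k : ℕ) (hβ : -1 < β) (ha : 0 < a)
    (he : -(a / 2) ≤ e) (hα0 : 0 ≤ α) (hα2 : α ≤ 2) :
    IntegrableOn (fun u => Real.cos (x * u) * Tf β k a e α u) (Ioi 0) := by
  simpa using integrableOn_cos_mul (integrableOn_Tf k hβ ha he hα0 hα2) x 0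

lemma integral_lin4 {f1 f2 f3 f4 : ℝ → ℝ} {s : Set ℝ} (i1 : IntegrableOn f1 s)
    (i2 : IntegrableOn f2 s) (i3 : IntegrableOn f3 s) (i4 : IntegrableOn f4 s) {c1 c2 c3 c4 : ℝ} :
    ∫ u in s, (c1 * f1 u - c2 * f2 u - c3 * f3 u - c4 * f4 u) =
      c1 * (∫ u in s, f1 u) - c2 * (∫ u in s, f2 u) - c3 * (∫ u in s, f3 u)
        - c4 * (∫ u in s, f4 u) := by
  have j1 := i1.const_mul c1
  have j2 := i2.const_mul c2
  have j3 := i3.const_mul c3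
  have j4 := i4.const_mul c4
  have e1 := integral_sub ((j1.sub j2).sub j3) j4
  have e2 := integral_sub (j1.sub j2) j3
  have e3 := integral_sub j1 j2
  simp only [Pi.sub_apply, integral_const_mul] at e1 e2 e3
  linarith

lemma hasDerivAt_Tf {a e α β : ℝ → ℝ} {a' e' α' β' t u : ℝ} (k : ℕ) (hu : 0 < u)
    (ha : HasDerivAt a a' t) (he : HasDerivAt e e' t) (hα : HasDerivAt α α' t)
    (hβ : HasDerivAt β β' t) :
    HasDerivAt (fun s => Tf (β s) k (a s) (e s) (α s) u)
      (β' * Tf (β t) (k + 1) (a t) (e t) (α t) u - a' * Tf (β t + 2) k (a t) (e t) (α t) u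
        - e' * Tf (β t + α t) k (a t) (e t) (α t) u
        - e t * α' * Tf (β t + α t) (k + 1) (a t) (e t) (α t) u) t := by
  unfold Tf
  have h1 := (hβ.const_rpow hu)
  have h2 := (hα.const_rpow hu)
  have h3 := ((ha.neg.mul_const (u ^ 2)).sub (he.mul h2)).exp
  have h4 := (h1.mul_const (Real.log u ^ k)).mul h3
  refine h4.congr_deriv ?_
  simp only [Pi.neg_apply, Pi.sub_apply, Pi.mul_apply]
  rw [Real.rpow_add hu, Real.rpow_add hu, Real.rpow_two]
  ring

lemma hasDerivAt_Bf {a e α β a' e' α' β' : ℝ → ℝ} {t0 : ℝ} (x : ℝ) (k : ℕ)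
    (ha : ∀ᶠ t in 𝓝 t0, HasDerivAt a (a' t) t) (he : ∀ᶠ t in 𝓝 t0, HasDerivAt e (e' t) t)
    (hα : ∀ᶠ t in 𝓝 t0, HasDerivAt α (α' t) t) (hβ : ∀ᶠ t in 𝓝 t0, HasDerivAt β (β' t) t)
    (hca : ContinuousAt a' t0) (hce : ContinuousAt e' t0) (hcα : ContinuousAt α' t0)
    (hcβ : ContinuousAt β' t0)
    (pa : 0 < a t0) (pe : 0 ≤ e t0) (pα : 0 < α t0) (pα2 : α t0 < 2) (pβ : 0 ≤ β t0) :
    HasDerivAt (fun t => Bf x (β t) k (a t) (e t) (α t))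
      (β' t0 * Bf x (β t0) (k + 1) (a t0) (e t0) (α t0)
        - a' t0 * Bf x (β t0 + 2) k (a t0) (e t0) (α t0)
        - e' t0 * Bf x (β t0 + α t0) k (a t0) (e t0) (α t0)
        - e t0 * α' t0 * Bf x (β t0 + α t0) (k + 1) (a t0) (e t0) (α t0)) t0 := by
  set a0 := a t0 / 2 with ha0
  have ca := ha.self_of_nhds.continuousAt
  have ce := he.self_of_nhds.continuousAt
  have cα := hα.self_of_nhds.continuousAt
  have cβ := hβ.self_of_nhds.continuousAt
  have pa0 : 0 < a0 := by positivity
  have E1 : ∀ᶠ t in 𝓝 t0, a0 < a t := ca.eventually (lt_mem_nhds (by linarith))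
  have E2 : ∀ᶠ t in 𝓝 t0, -(a0 / 2) < e t := ce.eventually (lt_mem_nhds (by linarith))
  have E3 : ∀ᶠ t in 𝓝 t0, 0 < α t := cα.eventually (lt_mem_nhds (by linarith))
  have E4 : ∀ᶠ t in 𝓝 t0, α t < 2 := cα.eventually (gt_mem_nhds (by linarith))
  have E5 : ∀ᶠ t in 𝓝 t0, -(1/2) < β t := cβ.eventually (lt_mem_nhds (by linarith))
  have E6 : ∀ᶠ t in 𝓝 t0, β t < β t0 + 1 := cβ.eventually (gt_mem_nhds (by linarith))
  have F1 : ∀ᶠ t in 𝓝 t0, |a' t| < |a' t0| + 1 := hca.abs.eventually (gt_mem_nhds (by linarith))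
  have F2 : ∀ᶠ t in 𝓝 t0, |e' t| < |e' t0| + 1 := hce.abs.eventually (gt_mem_nhds (by linarith))
  have F3 : ∀ᶠ t in 𝓝 t0, |e t * α' t| < |e t0 * α' t0| + 1 :=
    (ce.mul hcα).abs.eventually (gt_mem_nhds (by simp only [Pi.mul_apply]; linarith))
  have F4 : ∀ᶠ t in 𝓝 t0, |β' t| < |β' t0| + 1 := hcβ.abs.eventually (gt_mem_nhds (by linarith))
  set β1 := β t0 + 3 with hβ1
  set F' : ℝ → ℝ → ℝ := fun t u => Real.cos (x * u) *
    (β' t * Tf (β t) (k + 1) (a t) (e t) (α t) u - a' t * Tf (β t + 2) k (a t) (e t) (α t) u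
        - e' t * Tf (β t + α t) k (a t) (e t) (α t) u
        - e t * α' t * Tf (β t + α t) (k + 1) (a t) (e t) (α t) u) with hF'
  have main := hasDerivAt_integral_of_dominated_loc_of_deriv_le (𝕜 := ℝ)
    (μ := volume.restrict (Ioi (0:ℝ)))
    (F := fun t u => Real.cos (x * u) * Tf (β t) k (a t) (e t) (α t) u) (x₀ := t0)
    (bound := fun u => (|β' t0| + 1) * domf (-(1/2)) β1 (k + 1) a0 u
      + (|a' t0| + 1) * domf (-(1/2)) β1 k a0 u + (|e' t0| + 1) * domf (-(1/2)) β1 k a0 u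
      + (|e t0 * α' t0| + 1) * domf (-(1/2)) β1 (k + 1) a0 u)
    (F' := F')
    (Filter.Eventually.and ha (he.and (hα.and (hβ.and (E1.and (E2.and (E3.and (E4.and (E5.and
      (E6.and (F1.and (F2.and (F3.and F4)))))))))))))
    (Eventually.of_forall fun t => by
      apply Measurable.aestronglyMeasurable
      have := measurable_Tf (β t) k (a t) (e t) (α t)
      fun_prop)
    (integrableOn_cosTf x k (by linarith) pa (by linarith) pα.le pα2.le)
    (by
      apply Measurable.aestronglyMeasurable
      simp only [hF']
      have := measurable_Tf (β t0) (k+1) (a t0) (e t0) (α t0)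
      have := measurable_Tf (β t0 + 2) (k) (a t0) (e t0) (α t0)
      have := measurable_Tf (β t0 + α t0) (k) (a t0) (e t0) (α t0)
      have := measurable_Tf (β t0 + α t0) (k+1) (a t0) (e t0) (α t0)
      fun_prop)
    (by
      refine (ae_restrict_mem measurableSet_Ioi).mono ?_
      rintro u hu t ⟨_, _, _, _, e1, e2, e3, e4, e5, e6, f1, f2, f3, f4⟩
      have hu : 0 < u := hu
      have T1 := abs_Tf_le (β := β t) (β0 := -(1/2)) (β1 := β1) (a := a t) (e := e t) (α := α t)
        (k + 1) hu pa0 e1.le e2.le e3.le e4.le (by linarith) (by linarith)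
      have T2 := abs_Tf_le (β := β t + 2) (β0 := -(1/2)) (β1 := β1) (a := a t) (e := e t) (α := α t)
        k hu pa0 e1.le e2.le e3.le e4.le (by linarith) (by linarith)
      have T3 := abs_Tf_le (β := β t + α t) (β0 := -(1/2)) (β1 := β1) (a := a t) (e := e t)
        (α := α t) k hu pa0 e1.le e2.le e3.le e4.le (by linarith) (by linarith)
      have T4 := abs_Tf_le (β := β t + α t) (β0 := -(1/2)) (β1 := β1) (a := a t) (e := e t)
        (α := α t) (k + 1) hu pa0 e1.le e2.le e3.le e4.le (by linarith) (by linarith)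
      rw [Real.norm_eq_abs, abs_mul]
      refine (mul_le_of_le_one_left (abs_nonneg _) (Real.abs_cos_le_one _)).trans ?_
      refine (abs_sub _ _).trans (add_le_add ((abs_sub _ _).trans (add_le_add
        ((abs_sub _ _).trans (add_le_add ?_ ?_)) ?_)) ?_) <;>
      · rw [abs_mul]
        apply mul_le_mul (by linarith) (by assumption) (abs_nonneg _) (by positivity))
    (by
      have g1 := integrableOn_domf (β0 := -(1/2)) (β1 := β1) (by norm_num) (by linarith) pa0 k
      have g2 := integrableOn_domf (β0 := -(1/2)) (β1 := β1) (by norm_num) (by linarith) pa0 (k+1)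
      exact (((g2.const_mul _).add (g1.const_mul _)).add (g1.const_mul _)).add (g2.const_mul _))
    (by
      refine (ae_restrict_mem measurableSet_Ioi).mono ?_
      rintro u hu t ⟨d1, d2, d3, d4, -⟩
      exact (hasDerivAt_Tf k hu d1 d2 d3 d4).const_mul _)
  refine main.2.congr_deriv ?_
  have i1 := integrableOn_cosTf (β := β t0) (a := a t0) (e := e t0) (α := α t0) x (k+1)
    (by linarith) pa (by linarith) pα.le pα2.le
  have i2 := integrableOn_cosTf (β := β t0 + 2) (a := a t0) (e := e t0) (α := α t0) x (k)
    (by linarith) pa (by linarith) pα.le pα2.le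
  have i3 := integrableOn_cosTf (β := β t0 + α t0) (a := a t0) (e := e t0) (α := α t0) x (k)
    (by linarith) pa (by linarith) pα.le pα2.le
  have i4 := integrableOn_cosTf (β := β t0 + α t0) (a := a t0) (e := e t0) (α := α t0) x (k+1)
    (by linarith) pa (by linarith) pα.le pα2.le
  unfold Bf
  rw [← integral_lin4 i1 i2 i3 i4]
  refine integral_congr_ae (Eventually.of_forall fun u => ?_)
  simp only [hF']
  ring

lemma hasDerivAt_Tf_u (β : ℝ) (k : ℕ) (a e α : ℝ) {u : ℝ} (hu : 0 < u) :
    HasDerivAt (Tf β k a e α)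
      (β * Tf (β - 1) k a e α u - (-(k : ℝ)) * Tf (β - 1) (k - 1) a e α u
        - 2 * a * Tf (β + 1) k a e α u - e * α * Tf (β + α - 1) k a e α u) u := by
  unfold Tf
  have h1 := Real.hasDerivAt_rpow_const (x := u) (p := β) (Or.inl hu.ne')
  have h2 := (Real.hasDerivAt_log hu.ne').pow k
  have h3 := Real.hasDerivAt_rpow_const (x := u) (p := α) (Or.inl hu.ne')
  have h4 := (((hasDerivAt_pow 2 u).const_mul (-a)).sub (h3.const_mul e)).exp
  refine ((h1.mul h2).mul h4).congr_deriv ?_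
  simp only [Pi.mul_apply, Pi.pow_apply, Pi.sub_apply]
  have e1 : u ^ (β - 1) = u ^ β * u⁻¹ := by rw [Real.rpow_sub hu, Real.rpow_one]; rfl
  have e2 : u ^ (β + α - 1) = u ^ β * u ^ α * u⁻¹ := by
    rw [Real.rpow_sub hu, Real.rpow_add hu, Real.rpow_one]; rfl
  have e3 : u ^ (α - 1) = u ^ α * u⁻¹ := by rw [Real.rpow_sub hu, Real.rpow_one]; rfl
  have e4 : u ^ (β + 1) = u ^ β * u := by rw [Real.rpow_add hu, Real.rpow_one]
  rw [e1, e2, e3, e4]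
  push_cast
  ring

lemma abs_Tf_le' {β a e α u : ℝ} (k : ℕ) (hu : 0 < u) (he : 0 ≤ e) :
    |Tf β k a e α u| ≤ u ^ β * |Real.log u| ^ k * Real.exp (-a * u ^ 2) := by
  unfold Tf
  rw [abs_mul, abs_mul, abs_pow, abs_of_pos (Real.rpow_pos_of_pos hu β), abs_of_pos (Real.exp_pos _)]
  gcongr
  have : 0 ≤ e * u ^ α := mul_nonneg he (Real.rpow_nonneg hu.le _)
  linarith

lemma integrableOn_Tf_Ioi {β a e α s : ℝ} (k : ℕ) (hs : 0 < s) (ha : 0 < a) (he : 0 ≤ e) :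
    IntegrableOn (Tf β k a e α) (Ioi s) := by
  have h0 : IntegrableOn (fun u : ℝ => u ^ (β + |β|) * |Real.log u| ^ k * Real.exp (-a * u ^ 2)) (Ioi s) :=
    (integrableOn_dom (β := β + |β|) (by have := neg_abs_le β; linarith) ha k).mono_set
      (Ioi_subset_Ioi hs.le)
  refine Integrable.mono' (h0.const_mul (s ^ (-|β|))) (measurable_Tf _ _ _ _ _).aestronglyMeasurable ?_
  refine (ae_restrict_mem measurableSet_Ioi).mono ?_
  intro u hu
  have hu : s < u := hu
  have hu0 : 0 < u := hs.trans hu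
  refine (abs_Tf_le' k hu0 he).trans ?_
  have h1 : u ^ (-|β|) ≤ s ^ (-|β|) :=
    Real.rpow_le_rpow_of_nonpos hs hu.le (neg_nonpos.2 (abs_nonneg β))
  have h2 : u ^ β = u ^ (-|β|) * u ^ (β + |β|) := by
    rw [← Real.rpow_add hu0]; congr 1; ring
  rw [h2]
  have h3 : 0 ≤ u ^ (β + |β|) * |Real.log u| ^ k * Real.exp (-a * u ^ 2) := by positivity
  calc _ = u ^ (-|β|) * (u ^ (β + |β|) * |Real.log u| ^ k * Real.exp (-a * u ^ 2)) := by ring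
    _ ≤ _ := mul_le_mul_of_nonneg_right h1 h3

/-- decay claim at order `γ` -/
def Claim (a α γ : ℝ) : Prop :=
  ∀ β ≥ γ, ∀ k : ℕ, ∃ C ≥ (0 : ℝ), ∀ e ∈ Icc (0 : ℝ) 1, ∀ x ≥ (1 : ℝ), ∀ φ : ℝ,
    |∫ u in Ioi (1 / x), Real.cos (x * u + φ) * Tf β k a e α u| ≤
      C * (x ^ (-γ - 1) * (1 + Real.log x) ^ k)

lemma claim_base {a α γ : ℝ} (ha : 0 < a) (hγ : γ < -1) : Claim a α γ := by
  intro β hβ k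
  have hD := integrableOn_dom (β := |β|) (by have := abs_nonneg β; linarith) ha k
  set D : ℝ → ℝ := fun u : ℝ => u ^ |β| * |Real.log u| ^ k * Real.exp (-a * u ^ 2) with hDdef
  have hD0 : 0 ≤ ∫ u in Ioi (0:ℝ), D u :=
    setIntegral_nonneg measurableSet_Ioi fun u hu => by
      have : (0:ℝ) < u := hu
      positivity
  refine ⟨1 / (-γ - 1) + ∫ u in Ioi (0:ℝ), D u, by
    have : 0 < -γ - 1 := by linarith
    positivity, ?_⟩
  intro e he x hx φ
  have hx0 : 0 < x := by linarith
  have hs : 0 < 1 / x := by positivity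
  have hL : 1 ≤ 1 + Real.log x := by linarith [Real.log_nonneg hx]
  have hLk : 1 ≤ (1 + Real.log x) ^ k := one_le_pow₀ hL
  have hxg : 1 ≤ x ^ (-γ - 1) := Real.one_le_rpow hx (by linarith)
  have hDs : IntegrableOn D (Ioi (1 / x)) := hD.mono_set (Ioi_subset_Ioi hs.le)
  have hg : IntegrableOn (fun u : ℝ => u ^ γ) (Ioi (1 / x)) := integrableOn_Ioi_rpow_of_lt hγ hs
  have h1 : |∫ u in Ioi (1 / x), Real.cos (x * u + φ) * Tf β k a e α u| ≤
      ∫ u in Ioi (1 / x), ((1 + Real.log x) ^ k * u ^ γ + D u) := by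
    refine norm_integral_le_of_norm_le (G := ℝ) ((hg.const_mul _).add hDs) ?_
    refine (ae_restrict_mem measurableSet_Ioi).mono ?_
    intro u hu
    have hu : 1 / x < u := hu
    have hu0 : 0 < u := hs.trans hu
    rw [Real.norm_eq_abs, abs_mul]
    refine (mul_le_of_le_one_left (abs_nonneg _) (Real.abs_cos_le_one _)).trans ?_
    refine (abs_Tf_le' k hu0 he.1).trans ?_
    have hDu : 0 ≤ D u := by simp only [hDdef]; positivity
    have hgu : 0 ≤ (1 + Real.log x) ^ k * u ^ γ := by positivity
    rcases le_total u 1 with h | h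
    · refine le_trans ?_ (le_add_of_nonneg_right hDu)
      have e1 : u ^ β ≤ u ^ γ := Real.rpow_le_rpow_of_exponent_ge hu0 h hβ
      have e2 : Real.exp (-a * u ^ 2) ≤ 1 := Real.exp_le_one_iff.2 (by nlinarith [sq_nonneg u])
      have e3 : |Real.log u| ≤ 1 + Real.log x := by
        rw [abs_of_nonpos (Real.log_nonpos hu0.le h), ← Real.log_inv]
        have : u⁻¹ ≤ x := by
          rw [inv_le_comm₀ hu0 hx0, ← one_div]; exact hu.le
        have := Real.log_le_log (inv_pos.2 hu0) this
        linarith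
      calc _ ≤ u ^ γ * (1 + Real.log x) ^ k * 1 := by gcongr
        _ = _ := by ring
    · refine le_trans ?_ (le_add_of_nonneg_left hgu)
      simp only [hDdef]
      have : u ^ β ≤ u ^ |β| := Real.rpow_le_rpow_of_exponent_le h (le_abs_self β)
      gcongr
  have h2 : ∫ u in Ioi (1 / x), ((1 + Real.log x) ^ k * u ^ γ + D u) =
      (1 + Real.log x) ^ k * (∫ u in Ioi (1 / x), u ^ γ) + ∫ u in Ioi (1 / x), D u := by
    rw [integral_add (hg.const_mul _) hDs, integral_const_mul]
  have h3 : ∫ u in Ioi (1 / x), u ^ γ = x ^ (-γ - 1) / (-γ - 1) := by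
    rw [integral_Ioi_rpow_of_lt hγ hs, one_div, Real.inv_rpow hx0.le, ← Real.rpow_neg hx0.le]
    rw [show -(γ + 1) = -γ - 1 by ring, neg_div, ← div_neg, neg_add, sub_eq_add_neg]
  have h4 : ∫ u in Ioi (1 / x), D u ≤ ∫ u in Ioi (0:ℝ), D u := by
    refine setIntegral_mono_set hD ?_ (Ioi_subset_Ioi hs.le).eventuallyLE
    refine (ae_restrict_mem measurableSet_Ioi).mono ?_
    intro u hu
    have : (0:ℝ) < u := hu
    simp only [hDdef, Pi.zero_apply]; positivity
  rw [h2, h3] at h1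
  have h5 : 1 ≤ x ^ (-γ - 1) * (1 + Real.log x) ^ k := one_le_mul_of_one_le_of_one_le hxg hLk
  calc _ ≤ _ := h1
    _ ≤ (1 + Real.log x) ^ k * (x ^ (-γ - 1) / (-γ - 1))
        + (∫ u in Ioi (0:ℝ), D u) * (x ^ (-γ - 1) * (1 + Real.log x) ^ k) := by
      gcongr
      exact h4.trans (le_mul_of_one_le_right hD0 h5)
    _ = _ := by ring

lemma claim_step {a α γ : ℝ} (ha : 0 < a) (hα0 : 0 < α) (hα2 : α < 2)
    (h : Claim a α (γ - 1)) : Claim a α γ := by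
  intro β hβ k
  have hβ : γ ≤ β := hβ
  obtain ⟨C1, hC1, H1⟩ := h (β - 1) (by linarith) k
  obtain ⟨C2, hC2, H2⟩ := h (β - 1) (by linarith) (k - 1)
  obtain ⟨C3, hC3, H3⟩ := h (β + 1) (by show γ - 1 ≤ β + 1; linarith) k
  obtain ⟨C4, hC4, H4⟩ := h (β + α - 1) (by show γ - 1 ≤ β + α - 1; linarith) k
  refine ⟨1 + |β| * C1 + k * C2 + 2 * a * C3 + 2 * C4, by positivity, ?_⟩
  intro e he x hx φ
  have hx0 : 0 < x := by linarith
  have hs : 0 < 1 / x := by positivity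
  have hL : 1 ≤ 1 + Real.log x := by linarith [Real.log_nonneg hx]
  set s := 1 / x with hsdef
  set P := x ^ (-γ) * (1 + Real.log x) ^ k with hP
  have hP0 : 0 ≤ P := by positivity
  have G1 := H1 e he x hx (φ - Real.pi / 2)
  have G2 := H2 e he x hx (φ - Real.pi / 2)
  have G3 := H3 e he x hx (φ - Real.pi / 2)
  have G4 := H4 e he x hx (φ - Real.pi / 2)
  have hexp : -(γ - 1) - 1 = -γ := by ring
  rw [hexp] at G1 G2 G3 G4
  have hk1 : (1 + Real.log x) ^ (k - 1) ≤ (1 + Real.log x) ^ k :=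
    pow_le_pow_right₀ hL (Nat.sub_le _ _)
  replace G2 : |∫ u in Ioi s, Real.cos (x * u + (φ - Real.pi / 2)) * Tf (β - 1) (k - 1) a e α u|
      ≤ C2 * P := G2.trans (by rw [hP]; gcongr)
  have i0 := integrableOn_cos_mul (integrableOn_Tf_Ioi (β := β) (α := α) k hs ha he.1) x φ
  have j1 := integrableOn_Tf_Ioi (β := β - 1) (α := α) k hs ha he.1
  have j2 := integrableOn_Tf_Ioi (β := β - 1) (α := α) (k - 1) hs ha he.1
  have j3 := integrableOn_Tf_Ioi (β := β + 1) (α := α) k hs ha he.1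
  have j4 := integrableOn_Tf_Ioi (β := β + α - 1) (α := α) k hs ha he.1
  have i1 := integrableOn_cos_mul j1 x (φ - Real.pi / 2)
  have i2 := integrableOn_cos_mul j2 x (φ - Real.pi / 2)
  have i3 := integrableOn_cos_mul j3 x (φ - Real.pi / 2)
  have i4 := integrableOn_cos_mul j4 x (φ - Real.pi / 2)
  have hsin : ∀ u, Real.cos (x * u + (φ - Real.pi / 2)) = Real.sin (x * u + φ) := by
    intro u
    rw [← add_sub_assoc, Real.cos_sub_pi_div_two]
  set g : ℝ → ℝ := fun u => x * (Real.cos (x * u + φ) * Tf β k a e α u)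
    + (β * (Real.cos (x * u + (φ - Real.pi / 2)) * Tf (β - 1) k a e α u)
      - (-(k : ℝ)) * (Real.cos (x * u + (φ - Real.pi / 2)) * Tf (β - 1) (k - 1) a e α u)
      - 2 * a * (Real.cos (x * u + (φ - Real.pi / 2)) * Tf (β + 1) k a e α u)
      - e * α * (Real.cos (x * u + (φ - Real.pi / 2)) * Tf (β + α - 1) k a e α u)) with hg
  have hlin : IntegrableOn (fun u => (β * (Real.cos (x * u + (φ - Real.pi / 2)) * Tf (β - 1) k a e α u)
      - (-(k : ℝ)) * (Real.cos (x * u + (φ - Real.pi / 2)) * Tf (β - 1) (k - 1) a e α u)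
      - 2 * a * (Real.cos (x * u + (φ - Real.pi / 2)) * Tf (β + 1) k a e α u)
      - e * α * (Real.cos (x * u + (φ - Real.pi / 2)) * Tf (β + α - 1) k a e α u))) (Ioi s) :=
    (((i1.const_mul _).sub (i2.const_mul _)).sub (i3.const_mul _)).sub (i4.const_mul _)
  have hgi : IntegrableOn g (Ioi s) := (i0.const_mul _).add hlin
  have hder : ∀ u > 0, HasDerivAt (fun u => Real.sin (x * u + φ) * Tf β k a e α u) (g u) u := by
    intro u hu
    have d1 : HasDerivAt (fun u => Real.sin (x * u + φ)) (Real.cos (x * u + φ) * x) u := by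
      have := (((hasDerivAt_id u).const_mul x).add_const φ).sin
      simpa using this
    refine (d1.mul (hasDerivAt_Tf_u β k a e α hu)).congr_deriv ?_
    simp only [hg, hsin]
    ring
  have hFi : IntegrableOn (fun u => Real.sin (x * u + φ) * Tf β k a e α u) (Ioi s) := by
    have := integrableOn_cos_mul (integrableOn_Tf_Ioi (β := β) (α := α) k hs ha he.1) x
      (φ - Real.pi / 2)
    simpa only [hsin] using this
  have htend := tendsto_zero_of_hasDerivAt_of_integrableOn_Ioi
    (fun u hu => hder u (hs.trans hu)) hgi hFi
  have hintg := integral_Ioi_of_hasDerivAt_of_tendsto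
    (hder s hs).continuousAt.continuousWithinAt (fun u hu => hder u (hs.trans hu)) hgi htend
  have hsplit : ∫ u in Ioi s, g u = x * (∫ u in Ioi s, Real.cos (x * u + φ) * Tf β k a e α u) +
      (β * (∫ u in Ioi s, Real.cos (x * u + (φ - Real.pi / 2)) * Tf (β - 1) k a e α u)
      - (-(k : ℝ)) * (∫ u in Ioi s, Real.cos (x * u + (φ - Real.pi / 2)) * Tf (β - 1) (k - 1) a e α u)
      - 2 * a * (∫ u in Ioi s, Real.cos (x * u + (φ - Real.pi / 2)) * Tf (β + 1) k a e α u)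
      - e * α * (∫ u in Ioi s, Real.cos (x * u + (φ - Real.pi / 2)) * Tf (β + α - 1) k a e α u)) := by
    simp only [hg]
    rw [integral_add (i0.const_mul _) hlin, integral_const_mul, integral_lin4 i1 i2 i3 i4]
  rw [hsplit] at hintg
  set J := ∫ u in Ioi s, Real.cos (x * u + φ) * Tf β k a e α u
  set J1 := ∫ u in Ioi s, Real.cos (x * u + (φ - Real.pi / 2)) * Tf (β - 1) k a e α u
  set J2 := ∫ u in Ioi s, Real.cos (x * u + (φ - Real.pi / 2)) * Tf (β - 1) (k - 1) a e α u
  set J3 := ∫ u in Ioi s, Real.cos (x * u + (φ - Real.pi / 2)) * Tf (β + 1) k a e α u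
  set J4 := ∫ u in Ioi s, Real.cos (x * u + (φ - Real.pi / 2)) * Tf (β + α - 1) k a e α u
  have hbd : |Real.sin (x * s + φ) * Tf β k a e α s| ≤ P := by
    rw [abs_mul]
    refine (mul_le_of_le_one_left (abs_nonneg _) (Real.abs_sin_le_one _)).trans ?_
    refine (abs_Tf_le' k hs he.1).trans ?_
    have e1 : s ^ β ≤ x ^ (-γ) := by
      rw [hsdef, one_div, Real.inv_rpow hx0.le, ← Real.rpow_neg hx0.le]
      exact Real.rpow_le_rpow_of_exponent_le hx (by linarith)
    have e2 : Real.exp (-a * s ^ 2) ≤ 1 := Real.exp_le_one_iff.2 (by nlinarith [sq_nonneg s])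
    have e3 : |Real.log s| ≤ 1 + Real.log x := by
      rw [hsdef, one_div, Real.log_inv, abs_neg, abs_of_nonneg (Real.log_nonneg hx)]
      linarith
    calc _ ≤ x ^ (-γ) * (1 + Real.log x) ^ k * 1 := by gcongr
      _ = _ := by rw [mul_one]
  have hJ : x * J = -(Real.sin (x * s + φ) * Tf β k a e α s) - β * J1 - k * J2 + 2 * a * J3
      + e * α * J4 := by linarith
  have hxJ : x * |J| ≤ (1 + |β| * C1 + k * C2 + 2 * a * C3 + 2 * C4) * P := by
    have t0 : x * |J| = |x * J| := by rw [abs_mul, abs_of_pos hx0]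
    rw [t0, hJ]
    have t1 : |β * J1| ≤ |β| * C1 * P := by
      rw [abs_mul, mul_assoc]; gcongr
    have t2 : |(k:ℝ) * J2| ≤ k * C2 * P := by
      rw [abs_mul, mul_assoc, abs_of_nonneg (Nat.cast_nonneg k)]; gcongr
    have t3 : |2 * a * J3| ≤ 2 * a * C3 * P := by
      rw [abs_mul, mul_assoc (2 * a), abs_of_nonneg (by positivity : 0 ≤ 2 * a)]; gcongr
    have t4 : |e * α * J4| ≤ 2 * C4 * P := by
      rw [abs_mul, mul_assoc 2, abs_of_nonneg (mul_nonneg he.1 hα0.le)]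
      have : e * α ≤ 2 := by nlinarith [he.1, he.2]
      gcongr
    have q0 := abs_le.1 hbd
    have q1 := abs_le.1 t1
    have q2 := abs_le.1 t2
    have q3 := abs_le.1 t3
    have q4 := abs_le.1 t4
    rw [abs_le]
    constructor <;> linarith
  have hx1 : x ^ (-γ - 1) = x ^ (-γ) * x⁻¹ := by rw [Real.rpow_sub hx0, Real.rpow_one]; rfl
  have hJ' : |J| ≤ ((1 + |β| * C1 + k * C2 + 2 * a * C3 + 2 * C4) * P) / x := by
    rw [le_div_iff₀ hx0]; linarith
  refine hJ'.trans (le_of_eq ?_)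
  rw [hx1, hP]
  field_simp

lemma claim_main {a α : ℝ} (ha : 0 < a) (hα0 : 0 < α) (hα2 : α < 2) : Claim a α α := by
  apply claim_step ha hα0 hα2
  apply claim_step ha hα0 hα2
  apply claim_step ha hα0 hα2
  exact claim_base ha (by linarith)

lemma near_zero_aux {α v : ℝ} (hα : 0 < α) (k : ℕ) (hv : 0 < v) (hv1 : v ≤ 1) :
    v ^ α * (1 + |Real.log v|) ^ k ≤ (1 + (k + 1) / α) ^ k := by
  set s : ℝ := α / (k + 1) with hs
  have hs0 : 0 < s := by positivity
  have h1 : 1 + |Real.log v| ≤ (1 + 1 / s) * v ^ (-s) := by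
    have h := Real.log_le_rpow_div (x := v⁻¹) (by positivity) hs0
    rw [Real.log_inv, Real.inv_rpow hv.le, ← Real.rpow_neg hv.le] at h
    rw [abs_of_nonpos (Real.log_nonpos hv.le hv1)]
    have h2 : 1 ≤ v ^ (-s) := Real.one_le_rpow_of_pos_of_le_one_of_nonpos hv hv1 (by linarith)
    calc _ ≤ v ^ (-s) + v ^ (-s) / s := add_le_add h2 h
      _ = _ := by ring
  have h3 : (1 + 1 / s) = 1 + (k + 1) / α := by rw [hs, one_div_div]
  have h4 : (v ^ (-s)) ^ k * v ^ α ≤ 1 := by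
    rw [← Real.rpow_mul_natCast hv.le, ← Real.rpow_add hv]
    apply Real.rpow_le_one hv.le hv1
    have : s * (k + 1) = α := by rw [hs]; field_simp
    nlinarith
  calc v ^ α * (1 + |Real.log v|) ^ k ≤ v ^ α * ((1 + 1 / s) * v ^ (-s)) ^ k := by gcongr
    _ = (1 + 1 / s) ^ k * ((v ^ (-s)) ^ k * v ^ α) := by rw [mul_pow]; ring
    _ ≤ (1 + 1 / s) ^ k * 1 := by gcongr
    _ = _ := by rw [mul_one, h3]

lemma Bf_abs (x β : ℝ) (k : ℕ) (a e α : ℝ) : Bf |x| β k a e α = Bf x β k a e α := by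
  unfold Bf
  refine integral_congr_ae (Eventually.of_forall fun u => ?_)
  rcases abs_choice x with h | h <;> rw [h]
  simp only [neg_mul, Real.cos_neg]

/-- The weight -/
def Wt (α x : ℝ) : ℝ := (1 + |x|) ^ (-(α + 1))
/-- The logarithmic weight -/
def Lg (x : ℝ) : ℝ := 1 + Real.log (1 + |x|)

lemma Wt_pos (α x : ℝ) : 0 < Wt α x := Real.rpow_pos_of_pos (by positivity) _
lemma one_le_Lg (x : ℝ) : 1 ≤ Lg x := by
  unfold Lg
  have := Real.log_nonneg (x := 1 + |x|) (by linarith [abs_nonneg x])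
  linarith

theorem Bf_upper {a α : ℝ} (ha : 0 < a) (hα0 : 0 < α) (hα2 : α < 2) {β : ℝ} (hβ : α ≤ β) (k : ℕ) :
    ∃ C ≥ (0 : ℝ), ∀ e ∈ Icc (0 : ℝ) 1, ∀ x : ℝ,
      |Bf x β k a e α| ≤ C * (Lg x ^ k * Wt α x) := by
  obtain ⟨C, hC, H⟩ := claim_main ha hα0 hα2 β hβ k
  have hDi := integrableOn_domf (β0 := β) (β1 := β) (by linarith) (by linarith) ha k
  set K := ∫ u in Ioi (0:ℝ), domf β β k a u with hK
  have hK0 : 0 ≤ K := setIntegral_nonneg measurableSet_Ioi fun u hu => by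
    have : (0:ℝ) < u := hu
    unfold domf
    positivity
  set C0 : ℝ := (1 + (k + 1) / α) ^ k with hC0
  have hC00 : 0 ≤ C0 := by positivity
  refine ⟨2 ^ (α + 1) * (K + (C0 + C)), by positivity, ?_⟩
  intro e he x
  rcases le_total |x| 1 with hx | hx
  · have h1 : |Bf x β k a e α| ≤ K := by
      refine norm_integral_le_of_norm_le (G := ℝ) hDi ?_
      refine (ae_restrict_mem measurableSet_Ioi).mono ?_
      intro u hu
      rw [Real.norm_eq_abs, abs_mul]
      refine (mul_le_of_le_one_left (abs_nonneg _) (Real.abs_cos_le_one _)).trans ?_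
      exact abs_Tf_le k hu ha le_rfl (by linarith [he.1]) hα0.le hα2.le le_rfl le_rfl
    have h2 : 1 ≤ 2 ^ (α + 1) * Wt α x := by
      unfold Wt
      rw [Real.rpow_neg (by positivity), ← div_eq_mul_inv, one_le_div (by positivity)]
      exact Real.rpow_le_rpow (by positivity) (by linarith) (by linarith)
    have h3 : 1 ≤ Lg x ^ k := one_le_pow₀ (one_le_Lg x)
    have h4 : 1 ≤ (2 ^ (α + 1) * Wt α x) * Lg x ^ k := one_le_mul_of_one_le_of_one_le h2 h3
    calc |Bf x β k a e α| ≤ K := h1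
      _ ≤ K + (C0 + C) := by linarith
      _ ≤ (K + (C0 + C)) * ((2 ^ (α + 1) * Wt α x) * Lg x ^ k) :=
        le_mul_of_one_le_right (by positivity) h4
      _ = _ := by ring
  · rw [← Bf_abs]
    set X := |x| with hX
    have hX0 : 0 < X := by linarith
    have hs : 0 < 1 / X := by positivity
    have hL : 1 ≤ 1 + Real.log X := by linarith [Real.log_nonneg hx]
    have hi := integrableOn_cosTf (β := β) (e := e) (α := α) X k (by linarith) ha
      (by linarith [he.1]) hα0.le hα2.le
    have hsplit : Bf X β k a e α = (∫ u in Ioc 0 (1 / X), Real.cos (X * u) * Tf β k a e α u)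
        + ∫ u in Ioi (1 / X), Real.cos (X * u) * Tf β k a e α u := by
      unfold Bf
      rw [← setIntegral_union Ioc_disjoint_Ioi_same measurableSet_Ioi
        (hi.mono_set Ioc_subset_Ioi_self) (hi.mono_set (Ioi_subset_Ioi hs.le)),
        Ioc_union_Ioi_eq_Ioi hs.le]
    have h2 := H e he X hx 0
    simp only [add_zero] at h2
    set P := X ^ (-α - 1) * (1 + Real.log X) ^ k with hP
    have h1 : |∫ u in Ioc 0 (1 / X), Real.cos (X * u) * Tf β k a e α u| ≤ C0 * P := by
      have := norm_setIntegral_le_of_norm_le_const (μ := volume) (s := Ioc 0 (1 / X))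
        (f := fun u => Real.cos (X * u) * Tf β k a e α u)
        (C := C0 * (X ^ (-α) * (1 + Real.log X) ^ k)) (by simp) (by
        intro u hu
        have hu0 : 0 < u := hu.1
        have huX : X * u ≤ 1 := by
          have := hu.2
          rw [le_div_iff₀ hX0] at this; linarith
        have hu1 : u ≤ 1 := hu.2.trans (by rw [div_le_one hX0]; exact hx)
        rw [Real.norm_eq_abs, abs_mul]
        refine (mul_le_of_le_one_left (abs_nonneg _) (Real.abs_cos_le_one _)).trans ?_
        refine (abs_Tf_le' k hu0 he.1).trans ?_
        have e1 : u ^ β ≤ u ^ α := Real.rpow_le_rpow_of_exponent_ge hu0 hu1 hβ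
        have e2 : Real.exp (-a * u ^ 2) ≤ 1 := Real.exp_le_one_iff.2 (by nlinarith [sq_nonneg u])
        have e3 : |Real.log u| ≤ (1 + Real.log X) * (1 + |Real.log (X * u)|) := by
          rw [Real.log_mul hX0.ne' hu0.ne']
          have t1 : |Real.log u| ≤ |Real.log X + Real.log u| + Real.log X := by
            have := abs_sub (Real.log X + Real.log u) (Real.log X)
            rw [add_sub_cancel_left, abs_of_nonneg (by linarith : 0 ≤ Real.log X)] at this
            exact this
          nlinarith [abs_nonneg (Real.log X + Real.log u),
            mul_nonneg (by linarith : 0 ≤ Real.log X) (abs_nonneg (Real.log X + Real.log u))]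
        have e4 : u ^ α = X ^ (-α) * (X * u) ^ α := by
          rw [Real.mul_rpow hX0.le hu0.le, ← mul_assoc, ← Real.rpow_add hX0]
          simp
        have e5 := near_zero_aux hα0 k (mul_pos hX0 hu0) huX
        calc _ ≤ u ^ α * ((1 + Real.log X) * (1 + |Real.log (X * u)|)) ^ k * 1 := by gcongr
          _ = ((X * u) ^ α * (1 + |Real.log (X * u)|) ^ k) * (X ^ (-α) * (1 + Real.log X) ^ k) := by
            rw [e4, mul_pow]; ring
          _ ≤ _ := by gcongr)
      refine this.trans (le_of_eq ?_)
      rw [Real.volume_real_Ioc_of_le hs.le, hP, Real.rpow_sub hX0, Real.rpow_one, sub_zero]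
      ring
    have h3 : |Bf X β k a e α| ≤ (C0 + C) * P := by
      rw [hsplit]
      refine (abs_add_le _ _).trans ?_
      linarith
    have h4 : P ≤ 2 ^ (α + 1) * (Lg x ^ k * Wt α x) := by
      have e1 : X ^ (-α - 1) ≤ 2 ^ (α + 1) * Wt α x := by
        unfold Wt
        rw [← hX, Real.rpow_neg (by positivity), ← div_eq_mul_inv,
          ← Real.div_rpow (by positivity) (by positivity), show -α - 1 = -(α + 1) by ring,
          Real.rpow_neg hX0.le, ← Real.inv_rpow hX0.le]
        apply Real.rpow_le_rpow (by positivity) _ (by linarith)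
        rw [inv_eq_one_div, div_le_div_iff₀ hX0 (by positivity)]
        linarith
      have e2 : 1 + Real.log X ≤ Lg x := by
        unfold Lg
        have := Real.log_le_log hX0 (by linarith : X ≤ 1 + X)
        linarith
      calc P ≤ (2 ^ (α + 1) * Wt α x) * Lg x ^ k := by
            rw [hP]
            have := Wt_pos α x
            gcongr
        _ = _ := by ring
    calc _ ≤ (C0 + C) * P := h3
      _ ≤ (C0 + C) * (2 ^ (α + 1) * (Lg x ^ k * Wt α x)) := by gcongr
      _ ≤ (K + (C0 + C)) * (2 ^ (α + 1) * (Lg x ^ k * Wt α x)) := by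
        have := Wt_pos α x
        have := one_le_Lg x
        have : 0 ≤ 2 ^ (α + 1) * (Lg x ^ k * Wt α x) := by positivity
        apply mul_le_mul_of_nonneg_right _ this
        linarith
      _ = _ := by ring

lemma integral_cos_gauss (x : ℝ) {a : ℝ} (ha : 0 < a) :
    ∫ u : ℝ, Real.cos (x * u) * Real.exp (-a * u ^ 2) =
      Real.sqrt (Real.pi / a) * Real.exp (-x ^ 2 / (4 * a)) := by
  have h := fourierIntegral_gaussian (b := (a : ℂ)) (by simpa using ha) (x : ℂ)
  have hi : Integrable (fun u : ℝ => Complex.exp (Complex.I * x * u) * Complex.exp (-a * u ^ 2)) := by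
    have h0 : Integrable (fun u : ℝ => Complex.exp (-a * u ^ 2)) := by
      have := (integrable_exp_neg_mul_sq ha).ofReal (𝕜 := ℂ)
      refine this.congr (Eventually.of_forall fun u => ?_)
      change ((Real.exp (-a * u ^ 2) : ℝ) : ℂ) = _
      push_cast
      rfl
    refine Integrable.bdd_mul (c := 1) h0 (by
      apply Continuous.aestronglyMeasurable; fun_prop) ?_
    refine Eventually.of_forall fun u => ?_
    rw [show Complex.I * x * u = ((x * u : ℝ) : ℂ) * Complex.I by push_cast; ring,
      Complex.norm_exp_ofReal_mul_I]
  have h2 := integral_re (𝕜 := ℂ) hi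
  rw [h] at h2
  have h3 : ∀ u : ℝ, RCLike.re (Complex.exp (Complex.I * x * u) * Complex.exp (-a * u ^ 2)) =
      Real.cos (x * u) * Real.exp (-a * u ^ 2) := by
    intro u
    rw [show Complex.I * x * u = ((x * u : ℝ) : ℂ) * Complex.I by push_cast; ring,
      show (-(a : ℂ) * u ^ 2) = ((-a * u ^ 2 : ℝ) : ℂ) by push_cast; ring, ← Complex.ofReal_exp]
    rw [RCLike.re_eq_complex_re, Complex.re_mul_ofReal, Complex.exp_ofReal_mul_I_re]
  simp only [h3] at h2
  rw [h2]
  have h4 : ((Real.pi : ℂ) / a) ^ (1 / 2 : ℂ) * Complex.exp (-(x : ℂ) ^ 2 / (4 * a)) =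
      ((Real.sqrt (Real.pi / a) * Real.exp (-x ^ 2 / (4 * a)) : ℝ) : ℂ) := by
    rw [Real.sqrt_eq_rpow, Complex.ofReal_mul, Complex.ofReal_cpow (by positivity)]
    push_cast
    rfl
  rw [h4]
  exact Complex.ofReal_re _

/-- Gaussian main term -/
def gs (a x : ℝ) : ℝ := 1 / 2 * (Real.sqrt (Real.pi / a) * Real.exp (-x ^ 2 / (4 * a)))

lemma gs_pos {a : ℝ} (ha : 0 < a) (x : ℝ) : 0 < gs a x := by
  unfold gs; have := Real.pi_pos; positivity

lemma integral_Ioi_cos_gauss (x : ℝ) {a : ℝ} (ha : 0 < a) :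
    ∫ u in Ioi (0:ℝ), Real.cos (x * u) * Real.exp (-a * u ^ 2) = gs a x := by
  have h := integral_comp_abs (f := fun u => Real.cos (x * u) * Real.exp (-a * u ^ 2))
  have h2 : ∀ u : ℝ, Real.cos (x * |u|) * Real.exp (-a * |u| ^ 2) =
      Real.cos (x * u) * Real.exp (-a * u ^ 2) := by
    intro u
    rw [sq_abs]
    rcases abs_choice u with h | h <;> rw [h]
    rw [mul_neg, Real.cos_neg]
  simp only [h2] at h
  rw [integral_cos_gauss x ha] at h
  unfold gs
  linarith

lemma Bf_zero (x : ℝ) {a : ℝ} (ha : 0 < a) (α : ℝ) : Bf x 0 0 a 0 α = gs a x := by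
  rw [← integral_Ioi_cos_gauss x ha]
  unfold Bf Tf
  simp

lemma hasDerivAt_Bf_e {x β a e α : ℝ} (k : ℕ) (ha : 0 < a) (he : 0 ≤ e) (hα0 : 0 < α) (hα2 : α < 2)
    (hβ : 0 ≤ β) :
    HasDerivAt (fun s => Bf x β k a s α) (-Bf x (β + α) k a e α) e := by
  have := hasDerivAt_Bf (t0 := e) (a := fun _ => a) (e := fun s => s) (α := fun _ => α)
    (β := fun _ => β) (a' := fun _ => 0) (e' := fun _ => 1) (α' := fun _ => 0) (β' := fun _ => 0) x k
    (Eventually.of_forall fun t => hasDerivAt_const _ _) (Eventually.of_forall fun t => hasDerivAt_id' _)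
    (Eventually.of_forall fun t => hasDerivAt_const _ _)
    (Eventually.of_forall fun t => hasDerivAt_const _ _)
    continuousAt_const continuousAt_const continuousAt_const continuousAt_const ha he hα0 hα2 hβ
  refine this.congr_deriv ?_
  ring

lemma hasDerivAt_Bf_a {x β a e α : ℝ} (k : ℕ) (ha : 0 < a) (he : 0 ≤ e) (hα0 : 0 < α) (hα2 : α < 2)
    (hβ : 0 ≤ β) :
    HasDerivAt (fun s => Bf x β k s e α) (-Bf x (β + 2) k a e α) a := by
  have := hasDerivAt_Bf (t0 := a) (a := fun s => s) (e := fun _ => e) (α := fun _ => α)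
    (β := fun _ => β) (a' := fun _ => 1) (e' := fun _ => 0) (α' := fun _ => 0) (β' := fun _ => 0) x k
    (Eventually.of_forall fun t => hasDerivAt_id' _) (Eventually.of_forall fun t => hasDerivAt_const _ _)
    (Eventually.of_forall fun t => hasDerivAt_const _ _)
    (Eventually.of_forall fun t => hasDerivAt_const _ _)
    continuousAt_const continuousAt_const continuousAt_const continuousAt_const ha he hα0 hα2 hβ
  refine this.congr_deriv ?_
  ring

/-- log-derivative of `gs` in `a` -/
def rs (a x : ℝ) : ℝ := -1 / (2 * a) + x ^ 2 / (4 * a ^ 2)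

lemma hasDerivAt_gs (x : ℝ) {a : ℝ} (ha : 0 < a) :
    HasDerivAt (fun s => gs s x) (rs a x * gs a x) a := by
  have hp : 0 < Real.pi / a := div_pos Real.pi_pos ha
  have h1 := ((hasDerivAt_inv ha.ne').const_mul Real.pi).sqrt (by
    rw [← div_eq_mul_inv]; exact hp.ne')
  have h2 := ((hasDerivAt_inv ha.ne').const_mul (-x ^ 2 / 4)).exp
  have h3 := (h1.mul h2).const_mul (1 / 2)
  have h4 : (fun s => gs s x) = fun y => 1 / 2 * (((fun y => Real.sqrt (Real.pi * y⁻¹)) * fun y => Real.exp (-x ^ 2 / 4 * y⁻¹)) y) := by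
    funext s
    simp only [gs, Pi.mul_apply]
    congr 3
    rw [← div_div, div_eq_mul_inv (-x ^ 2 / 4) s]
  rw [h4]
  refine h3.congr_deriv ?_
  unfold gs rs
  have e1 : Real.exp (-x ^ 2 / 4 * a⁻¹) = Real.exp (-x ^ 2 / (4 * a)) := by
    congr 1; field_simp
  rw [e1, ← div_eq_mul_inv]
  set S := Real.sqrt (Real.pi / a) with hS
  have hS0 : 0 < S := Real.sqrt_pos.2 hp
  have hSS : Real.pi = S ^ 2 * a := by
    rw [hS, Real.sq_sqrt hp.le]; field_simp
  have e2 : Real.pi * -(a ^ 2)⁻¹ / (2 * S) = -S / (2 * a) := by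
    rw [hSS]; field_simp
  rw [e2]
  field_simp

lemma Bf_two (x : ℝ) {a : ℝ} (ha : 0 < a) {α : ℝ} (hα0 : 0 < α) (hα2 : α < 2) :
    Bf x 2 0 a 0 α = -(rs a x * gs a x) := by
  have h1 := hasDerivAt_Bf_a (x := x) (β := 0) 0 ha le_rfl hα0 hα2 le_rfl
  have h2 : HasDerivAt (fun s => Bf x 0 0 s 0 α) (rs a x * gs a x) a := by
    refine (hasDerivAt_gs x ha).congr_of_eventuallyEq ?_
    filter_upwards [lt_mem_nhds ha] with s hs
    exact Bf_zero x hs α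
  have := h1.unique h2
  rw [zero_add] at this
  linarith

lemma Bf_four (x : ℝ) {a : ℝ} (ha : 0 < a) {α : ℝ} (hα0 : 0 < α) (hα2 : α < 2) :
    Bf x 4 0 a 0 α = (1 / (2 * a ^ 2) - x ^ 2 / (2 * a ^ 3) + rs a x ^ 2) * gs a x := by
  have h1 := hasDerivAt_Bf_a (x := x) (β := 2) 0 ha le_rfl hα0 hα2 (by norm_num)
  have hr : HasDerivAt (fun s => rs s x) (1 / (2 * a ^ 2) - x ^ 2 / (2 * a ^ 3)) a := by
    unfold rs
    have d1 := (hasDerivAt_inv ha.ne').const_mul (-1 / 2)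
    have d2 := ((hasDerivAt_inv ha.ne').pow 2).const_mul (x ^ 2 / 4)
    refine ((d1.add d2).congr_deriv ?_).congr_of_eventuallyEq ?_
    · push_cast
      field_simp
      ring
    · filter_upwards [lt_mem_nhds ha] with s hs
      simp only [Pi.add_apply, Pi.pow_apply]
      field_simp
  have h2 : HasDerivAt (fun s => Bf x 2 0 s 0 α)
      (-((1 / (2 * a ^ 2) - x ^ 2 / (2 * a ^ 3)) * gs a x + rs a x * (rs a x * gs a x))) a := by
    refine (hr.mul (hasDerivAt_gs x ha)).neg.congr_of_eventuallyEq ?_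
    filter_upwards [lt_mem_nhds ha] with s hs
    exact Bf_two x hs hα0 hα2
  have := h1.unique h2
  rw [show (2 : ℝ) + 2 = 4 by norm_num] at this
  linear_combination -this

lemma Bf_gauss_bound {a : ℝ} (ha : 0 < a) {α : ℝ} (hα0 : 0 < α) (hα2 : α < 2) :
    ∃ C ≥ (0 : ℝ), ∀ x : ℝ, |Bf x 2 0 a 0 α| ≤ C * ((1 + x ^ 2) * gs a x) ∧
      |Bf x 4 0 a 0 α| ≤ C * ((1 + x ^ 2) ^ 2 * gs a x) := by
  set c1 := 1 / (2 * a) + 1 / (4 * a ^ 2) with hc1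
  set c2 := 1 / (2 * a ^ 2) + 1 / (2 * a ^ 3) with hc2
  have p1 : 0 ≤ c1 := by positivity
  have p2 : 0 ≤ c2 := by positivity
  refine ⟨c1 + c2 + c1 ^ 2, by positivity, fun x => ?_⟩
  have hg := gs_pos ha x
  have hx := sq_nonneg x
  have hr : |rs a x| ≤ c1 * (1 + x ^ 2) := by
    have q1 : 0 ≤ 1 / (2 * a) := by positivity
    have q2 : 0 ≤ 1 / (4 * a ^ 2) := by positivity
    have : rs a x = -(1 / (2 * a)) + (1 / (4 * a ^ 2)) * x ^ 2 := by unfold rs; ring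
    rw [this, hc1, abs_le]
    constructor <;> nlinarith [mul_nonneg q1 hx, mul_nonneg q2 hx]
  have hr2 : |1 / (2 * a ^ 2) - x ^ 2 / (2 * a ^ 3)| ≤ c2 * (1 + x ^ 2) := by
    have q1 : 0 ≤ 1 / (2 * a ^ 2) := by positivity
    have q2 : 0 ≤ 1 / (2 * a ^ 3) := by positivity
    have : 1 / (2 * a ^ 2) - x ^ 2 / (2 * a ^ 3) = (1 / (2 * a ^ 2)) - (1 / (2 * a ^ 3)) * x ^ 2 := by ring
    rw [this, hc2, abs_le]
    constructor <;> nlinarith [mul_nonneg q1 hx, mul_nonneg q2 hx]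
  constructor
  · rw [Bf_two x ha hα0 hα2, abs_neg, abs_mul, abs_of_pos hg]
    calc _ ≤ (c1 * (1 + x ^ 2)) * gs a x := by gcongr
      _ = c1 * ((1 + x ^ 2) * gs a x) := by ring
      _ ≤ _ := by
        gcongr
        nlinarith [sq_nonneg c1]
  · rw [Bf_four x ha hα0 hα2, abs_mul, abs_of_pos hg]
    have h5 : |1 / (2 * a ^ 2) - x ^ 2 / (2 * a ^ 3) + rs a x ^ 2| ≤
        (c2 + c1 ^ 2) * (1 + x ^ 2) ^ 2 := by
      refine (abs_add_le _ _).trans ?_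
      rw [abs_pow]
      calc _ ≤ c2 * (1 + x ^ 2) + (c1 * (1 + x ^ 2)) ^ 2 := by gcongr
        _ ≤ c2 * (1 + x ^ 2) ^ 2 + (c1 * (1 + x ^ 2)) ^ 2 := by
          gcongr; nlinarith
        _ = _ := by ring
    calc _ ≤ ((c2 + c1 ^ 2) * (1 + x ^ 2) ^ 2) * gs a x := by gcongr
      _ = (c2 + c1 ^ 2) * ((1 + x ^ 2) ^ 2 * gs a x) := by ring
      _ ≤ _ := by
        gcongr
        linarith

lemma Bf_pert {a α : ℝ} (ha : 0 < a) (hα0 : 0 < α) (hα2 : α < 2) {β : ℝ} (hβ : 0 ≤ β) :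
    ∃ C ≥ (0 : ℝ), ∀ e ∈ Icc (0 : ℝ) 1, ∀ x : ℝ,
      |Bf x β 0 a e α - Bf x β 0 a 0 α| ≤ C * (e * Wt α x) := by
  obtain ⟨C, hC, H⟩ := Bf_upper ha hα0 hα2 (β := β + α) (by linarith) 0
  refine ⟨C, hC, fun e he x => ?_⟩
  have := norm_image_sub_le_of_norm_deriv_le_segment' (f := fun s => Bf x β 0 a s α) (a := 0) (b := e)
    (C := C * Wt α x) (f' := fun s => -Bf x (β + α) 0 a s α)
    (fun s hs => (hasDerivAt_Bf_e 0 ha hs.1 hα0 hα2 hβ).hasDerivWithinAt)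
    (fun s hs => by
      rw [norm_neg, Real.norm_eq_abs]
      have := H s ⟨hs.1, hs.2.le.trans he.2⟩ x
      simpa using this) e ⟨he.1, le_rfl⟩
  rw [Real.norm_eq_abs] at this
  refine this.trans (le_of_eq ?_)
  ring

lemma Bf_pert2 {a α : ℝ} (ha : 0 < a) (hα0 : 0 < α) (hα2 : α < 2) :
    ∃ C ≥ (0 : ℝ), ∀ e ∈ Icc (0 : ℝ) 1, ∀ x : ℝ,
      |Bf x 0 0 a e α - Bf x 0 0 a 0 α + e * Bf x α 0 a 0 α| ≤ C * (e ^ 2 * Wt α x) := by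
  obtain ⟨C, hC, H⟩ := Bf_pert ha hα0 hα2 (β := α) hα0.le
  refine ⟨C, hC, fun e he x => ?_⟩
  have hW := Wt_pos α x
  have := norm_image_sub_le_of_norm_deriv_le_segment'
    (f := fun s => Bf x 0 0 a s α + s * Bf x α 0 a 0 α) (a := 0) (b := e)
    (C := C * (e * Wt α x)) (f' := fun s => -Bf x (0 + α) 0 a s α + 1 * Bf x α 0 a 0 α)
    (fun s hs => ((hasDerivAt_Bf_e 0 ha hs.1 hα0 hα2 le_rfl).add
      ((hasDerivAt_id' s).mul_const _)).hasDerivWithinAt)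
    (fun s hs => by
      have h1 := H s ⟨hs.1, hs.2.le.trans he.2⟩ x
      rw [zero_add, Real.norm_eq_abs, one_mul, neg_add_eq_sub, abs_sub_comm]
      refine h1.trans ?_
      have := hs.2.le
      gcongr) e ⟨he.1, le_rfl⟩
  rw [Real.norm_eq_abs] at this
  calc _ = |Bf x 0 0 a e α + e * Bf x α 0 a 0 α - (Bf x 0 0 a 0 α + 0 * Bf x α 0 a 0 α)| := by
        congr 1; ring
    _ ≤ _ := this
    _ = _ := by ring

lemma poly_gauss (m : ℕ) {c : ℝ} (hc : 0 < c) :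
    ∃ C > 0, ∀ x : ℝ, (1 + |x|) ^ m * Real.exp (-(c * x ^ 2)) ≤ C := by
  refine ⟨m.factorial * Real.exp (1 + 1 / (4 * c)), by positivity, fun x => ?_⟩
  have h1 := Real.pow_div_factorial_le_exp (1 + |x|) (by positivity) m
  rw [div_le_iff₀ (by positivity)] at h1
  calc (1 + |x|) ^ m * Real.exp (-(c * x ^ 2))
      ≤ (Real.exp (1 + |x|) * m.factorial) * Real.exp (-(c * x ^ 2)) := by gcongr
    _ = m.factorial * Real.exp (1 + |x| + -(c * x ^ 2)) := by rw [Real.exp_add (1 + |x|)]; ring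
    _ ≤ _ := by
      refine mul_le_mul_of_nonneg_left (Real.exp_le_exp.2 ?_) (by positivity)
      have : |x| - c * x ^ 2 ≤ 1 / (4 * c) := by
        rw [le_div_iff₀ (by positivity), ← sq_abs x]
        nlinarith [sq_nonneg (2 * c * |x| - 1)]
      linarith

lemma cosh_lower (t : ℝ) : 1 + t ^ 2 / 2 ≤ Real.cosh t := by
  have h : Real.cosh t = 1 + 2 * Real.sinh (t / 2) ^ 2 := by
    have := Real.cosh_two_mul (t / 2)
    rw [mul_div_cancel₀ t (two_ne_zero)] at this
    rw [this, Real.cosh_sq]; ring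
  have h2 : (t / 2) ^ 2 ≤ Real.sinh (t / 2) ^ 2 := by
    rw [← sq_abs (t / 2), ← sq_abs (Real.sinh (t / 2)), Real.abs_sinh]
    have : |t / 2| ≤ Real.sinh |t / 2| := Real.self_le_sinh_iff.2 (abs_nonneg _)
    gcongr
  rw [h]; nlinarith

lemma gs_neg (a x : ℝ) : gs a (-x) = gs a x := by unfold gs; simp

lemma gs_anti {a x y : ℝ} (ha : 0 < a) (h : |x| ≤ |y|) : gs a y ≤ gs a x := by
  unfold gs
  have := sq_le_sq.2 h
  gcongr

lemma gs_bracket {a x z : ℝ} (ha : 0 < a) (hx : 4 * a ≤ x ^ 2) (hz : z ^ 2 ≤ 2 * a) :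
    0 ≤ 1 / 2 * (gs a (x + z) + gs a (x - z)) - gs a x := by
  have e1 : gs a (x + z) = gs a x * (Real.exp (-(z ^ 2 / (4 * a))) * Real.exp (-(x * z / (2 * a)))) := by
    unfold gs
    rw [← Real.exp_add, mul_assoc, mul_assoc, ← Real.exp_add]
    congr 3
    field_simp; ring
  have e2 : gs a (x - z) = gs a x * (Real.exp (-(z ^ 2 / (4 * a))) * Real.exp (x * z / (2 * a))) := by
    unfold gs
    rw [← Real.exp_add, mul_assoc, mul_assoc, ← Real.exp_add]
    congr 3
    field_simp; ring
  have e3 : 1 / 2 * (gs a (x + z) + gs a (x - z)) - gs a x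
      = gs a x * (Real.exp (-(z ^ 2 / (4 * a))) * Real.cosh (x * z / (2 * a)) - 1) := by
    rw [e1, e2, Real.cosh_eq]; ring
  rw [e3]
  refine mul_nonneg (gs_pos ha x).le (sub_nonneg.2 ?_)
  have h1 := Real.one_sub_le_exp_neg (z ^ 2 / (4 * a))
  have h2 := cosh_lower (x * z / (2 * a))
  set s := z ^ 2 / (4 * a) with hs
  have hs0 : 0 ≤ s := by positivity
  have hs1 : s ≤ 1 / 2 := by rw [hs, div_le_iff₀ (by positivity)]; linarith
  have h3 : (x * z / (2 * a)) ^ 2 / 2 = s * (x ^ 2 / (2 * a)) := by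
    rw [hs]; field_simp; ring
  have hX : 2 ≤ x ^ 2 / (2 * a) := by rw [le_div_iff₀ (by positivity)]; linarith
  rw [h3] at h2
  have h4 : 1 + s * 2 ≤ Real.cosh (x * z / (2 * a)) := by nlinarith
  calc (1 : ℝ) ≤ (1 - s) * (1 + s * 2) := by nlinarith
    _ ≤ _ := by gcongr

lemma integrableOn_K {α : ℝ} (hα0 : 0 < α) (hα2 : α < 2) :
    IntegrableOn (fun z : ℝ => (1 - Real.cos z) * z ^ (-1 - α)) (Ioi 0) := by
  have hm : Measurable (fun z : ℝ => (1 - Real.cos z) * z ^ (-1 - α)) := by fun_prop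
  rw [← Ioc_union_Ioi_eq_Ioi (zero_le_one' ℝ)]
  refine IntegrableOn.union ?_ ?_
  · have h : IntegrableOn (fun z : ℝ => z ^ (1 - α)) (Ioc 0 1) := by
      rw [← intervalIntegrable_iff_integrableOn_Ioc_of_le zero_le_one]
      exact intervalIntegral.intervalIntegrable_rpow' (by linarith)
    refine Integrable.mono' h hm.aestronglyMeasurable ?_
    refine (ae_restrict_iff' measurableSet_Ioc).2 (Eventually.of_forall fun z hz => ?_)
    have hz0 : 0 < z := hz.1
    rw [Real.norm_of_nonneg (mul_nonneg (by linarith [Real.cos_le_one z]) (by positivity))]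
    have h1 := Real.one_sub_sq_div_two_le_cos (x := z)
    calc (1 - Real.cos z) * z ^ (-1 - α) ≤ z ^ (2:ℝ) * z ^ (-1 - α) := by
          gcongr
          rw [Real.rpow_two]; nlinarith [sq_nonneg z]
      _ = z ^ (1 - α) := by rw [← Real.rpow_add hz0]; congr 1; ring
  · have h : IntegrableOn (fun z : ℝ => 2 * z ^ (-1 - α)) (Ioi 1) :=
      (integrableOn_Ioi_rpow_of_lt (by linarith) zero_lt_one).const_mul 2
    refine Integrable.mono' h hm.aestronglyMeasurable ?_
    refine (ae_restrict_iff' measurableSet_Ioi).2 (Eventually.of_forall fun z hz => ?_)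
    have hz0 : 0 < z := lt_trans zero_lt_one hz
    rw [Real.norm_of_nonneg (mul_nonneg (by linarith [Real.cos_le_one z]) (by positivity))]
    gcongr
    linarith [Real.neg_one_le_cos z]

def Kc (α : ℝ) : ℝ := ∫ z in Ioi (0:ℝ), (1 - Real.cos z) * z ^ (-1 - α)

lemma Kc_nonneg (α : ℝ) : 0 ≤ Kc α := by
  refine setIntegral_nonneg measurableSet_Ioi fun z hz => ?_
  have hz0 : 0 < z := hz
  exact mul_nonneg (by linarith [Real.cos_le_one z]) (by positivity)

lemma kern_eq {α u z : ℝ} (hu : 0 < u) (hz : 0 < z) :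
    (1 - Real.cos (u * z)) * z ^ (-1 - α) =
      u ^ (1 + α) * ((1 - Real.cos (u * z)) * (u * z) ^ (-1 - α)) := by
  rw [Real.mul_rpow hu.le hz.le, show -1 - α = -(1 + α) by ring, Real.rpow_neg hu.le]
  have : u ^ (1 + α) ≠ 0 := by positivity
  field_simp

lemma integrableOn_kern {α u : ℝ} (hα0 : 0 < α) (hα2 : α < 2) (hu : 0 < u) :
    IntegrableOn (fun z : ℝ => (1 - Real.cos (u * z)) * z ^ (-1 - α)) (Ioi 0) := by
  have h := (integrableOn_Ioi_comp_mul_left_iff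
    (fun z : ℝ => (1 - Real.cos z) * z ^ (-1 - α)) 0 hu).2 (by simpa using integrableOn_K hα0 hα2)
  refine IntegrableOn.congr_fun (h.const_mul (u ^ (1 + α))) (fun z hz => ?_) measurableSet_Ioi
  exact (kern_eq hu hz).symm

lemma integral_kern {α u : ℝ} (hu : 0 < u) :
    ∫ z in Ioi (0:ℝ), (1 - Real.cos (u * z)) * z ^ (-1 - α) = u ^ α * Kc α := by
  rw [setIntegral_congr_fun measurableSet_Ioi (fun z hz => kern_eq hu hz), integral_const_mul,
    integral_comp_mul_left_Ioi (fun z : ℝ => (1 - Real.cos z) * z ^ (-1 - α)) 0 hu]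
  simp only [mul_zero, smul_eq_mul]
  rw [Real.rpow_add hu, Real.rpow_one, ← Kc]
  field_simp

lemma levy_rep (x : ℝ) {a α : ℝ} (ha : 0 < a) (hα0 : 0 < α) (hα2 : α < 2) :
    IntegrableOn (fun z : ℝ => z ^ (-1 - α) * (1 / 2 * (gs a (x + z) + gs a (x - z)) - gs a x)) (Ioi 0)
    ∧ ∫ z in Ioi (0:ℝ), z ^ (-1 - α) * (1 / 2 * (gs a (x + z) + gs a (x - z)) - gs a x)
      = Kc α * (- Bf x α 0 a 0 α) := by
  set F : ℝ → ℝ → ℝ := fun u z => Real.cos (x * u) * Real.exp (-a * u ^ 2) *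
    ((1 - Real.cos (u * z)) * z ^ (-1 - α)) with hF
  have hFm : Measurable (Function.uncurry F) := by
    simp only [hF, Function.uncurry_def]; fun_prop
  have hTf : ∀ u : ℝ, Tf α 0 a 0 α u = Real.exp (-a * u ^ 2) * u ^ α := by
    intro u; simp [Tf]; ring
  have hgi : ∀ x : ℝ, IntegrableOn (fun u : ℝ => Real.cos (x * u) * Real.exp (-a * u ^ 2)) (Ioi 0) := by
    intro x
    have := integrableOn_cosTf x 0 (β := 0) (by norm_num) ha (e := 0) (by linarith) hα0.le hα2.le
    refine this.congr_fun (fun u hu => ?_) measurableSet_Ioi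
    simp [Tf]
  have hintg : Integrable (Function.uncurry F) ((volume.restrict (Ioi 0)).prod (volume.restrict (Ioi 0))) := by
    rw [integrable_prod_iff hFm.aestronglyMeasurable]
    constructor
    · refine (ae_restrict_iff' measurableSet_Ioi).2 (Eventually.of_forall fun u hu => ?_)
      exact (integrableOn_kern hα0 hα2 hu).const_mul (Real.cos (x * u) * Real.exp (-a * u ^ 2))
    · have h1 := (integrableOn_cosTf x 0 (β := α) (by linarith) ha (e := 0) (by linarith) hα0.le hα2.le).norm.mul_const (Kc α)
      refine IntegrableOn.congr_fun h1 (fun u hu => ?_) measurableSet_Ioi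
      have hu0 : 0 < u := hu
      simp only [Function.uncurry_apply_pair, hF, hTf, norm_mul]
      rw [integral_const_mul]
      have : ∫ z in Ioi (0:ℝ), ‖1 - Real.cos (u * z)‖ * ‖z ^ (-1 - α)‖ = u ^ α * Kc α := by
        rw [← integral_kern hu0]
        refine setIntegral_congr_fun measurableSet_Ioi fun z hz => ?_
        have hz0 : 0 < z := hz
        rw [Real.norm_of_nonneg (by linarith [Real.cos_le_one (u * z)]), Real.norm_of_nonneg (by positivity)]
      rw [this, Real.norm_of_nonneg (by positivity : 0 ≤ u ^ α)]
      ring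
  have hz : ∀ z : ℝ, ∫ u in Ioi (0:ℝ), F u z =
      -(z ^ (-1 - α) * (1 / 2 * (gs a (x + z) + gs a (x - z)) - gs a x)) := by
    intro z
    have e : ∀ u, F u z = z ^ (-1 - α) * (Real.cos (x * u) * Real.exp (-a * u ^ 2) -
        (1 / 2 * (Real.cos ((x + z) * u) * Real.exp (-a * u ^ 2)) +
         1 / 2 * (Real.cos ((x - z) * u) * Real.exp (-a * u ^ 2)))) := by
      intro u
      simp only [hF]
      rw [show (x + z) * u = x * u + u * z by ring, show (x - z) * u = x * u - u * z by ring,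
        Real.cos_add, Real.cos_sub]
      ring
    simp only [e]
    have hsum : IntegrableOn (fun u : ℝ => 1 / 2 * (Real.cos ((x + z) * u) * Real.exp (-a * u ^ 2)) +
         1 / 2 * (Real.cos ((x - z) * u) * Real.exp (-a * u ^ 2))) (Ioi 0) :=
      ((hgi _).const_mul _).add ((hgi _).const_mul _)
    rw [integral_const_mul, integral_sub (hgi x) hsum,
      integral_add ((hgi _).const_mul _) ((hgi _).const_mul _), integral_const_mul, integral_const_mul,
      integral_Ioi_cos_gauss _ ha, integral_Ioi_cos_gauss _ ha, integral_Ioi_cos_gauss _ ha]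
    ring
  constructor
  · have := hintg.integral_prod_right
    simp only [Function.uncurry_apply_pair, hz] at this
    have h2 := this.neg
    refine h2.congr (Eventually.of_forall fun z => ?_)
    simp
  · have h := integral_integral_swap hintg
    simp only [hz] at h
    rw [integral_neg] at h
    rw [← neg_eq_iff_eq_neg.2 h, Bf, mul_neg, ← integral_const_mul]
    congr 1
    refine setIntegral_congr_fun measurableSet_Ioi fun u hu => ?_
    simp only [hF]
    rw [integral_const_mul, integral_kern hu, hTf]
    ring

lemma Bf_lower {a α : ℝ} (ha : 0 < a) (hα0 : 0 < α) (hα2 : α < 2) :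
    ∃ c > 0, ∃ M ≥ (1:ℝ), ∀ x : ℝ, M ≤ |x| → c * Wt α x ≤ - Bf x α 0 a 0 α := by
  obtain ⟨C, hC, hC'⟩ := poly_gauss 4 (c := 1 / (4 * a)) (by positivity)
  set b := Real.sqrt (2 * a) with hb
  have hb0 : 0 < b := by positivity
  set D := b ^ (-α) / α with hD
  have hD0 : 0 < D := by positivity
  set g1 := gs a 1 with hg1
  have hg1p : 0 < g1 := gs_pos ha 1
  set A := 1 / 2 * Real.sqrt (Real.pi / a) with hA
  have hA0 : 0 < A := by have := Real.pi_pos; positivity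
  set M := max 1 (max (2 * b) (4 * D * A * C / g1)) with hM
  have key : ∀ x : ℝ, M ≤ x → g1 / 4 * (1 + x) ^ (-(α + 1)) ≤ Kc α * (- Bf x α 0 a 0 α) := by
    intro x hx
    have hx1 : 1 ≤ x := le_trans (le_max_left _ _) hx
    have hx2 : 2 * b ≤ x := le_trans ((le_max_left _ _).trans (le_max_right _ _)) hx
    have hx3 : 4 * D * A * C / g1 ≤ x := le_trans ((le_max_right _ _).trans (le_max_right _ _)) hx
    have hb2 : b ^ 2 = 2 * a := Real.sq_sqrt (by positivity)
    have hx0 : 0 < x := by linarith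
    obtain ⟨hGi, hGe⟩ := levy_rep x ha hα0 hα2
    rw [← hGe]
    set c1 := 1 / 2 * g1 * (x + 1) ^ (-1 - α) with hc1
    have hc1p : 0 < c1 := by positivity
    set H : ℝ → ℝ := fun z => (Ioc x (x + 1)).indicator (fun _ => c1) z -
      (Ioi b).indicator (fun z => gs a x * z ^ (-1 - α)) z with hH
    have hI1 : IntegrableOn ((Ioc x (x + 1)).indicator (fun _ : ℝ => c1)) (Ioi 0) := by
      refine Integrable.integrableOn ?_
      rw [integrable_indicator_iff measurableSet_Ioc]
      exact integrableOn_const (by simp)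
    have hI2 : IntegrableOn ((Ioi b).indicator (fun z : ℝ => gs a x * z ^ (-1 - α))) (Ioi 0) := by
      refine Integrable.integrableOn ?_
      rw [integrable_indicator_iff measurableSet_Ioi]
      exact (integrableOn_Ioi_rpow_of_lt (by linarith) hb0).const_mul _
    have hHint : ∫ z in Ioi (0:ℝ), H z = c1 - gs a x * D := by
      simp only [hH]
      rw [integral_sub hI1 hI2, setIntegral_indicator measurableSet_Ioc,
        setIntegral_indicator measurableSet_Ioi,
        inter_eq_right.2 (show Ioc x (x + 1) ⊆ Ioi 0 from fun z hz => lt_trans hx0 hz.1),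
        inter_eq_right.2 (show Ioi b ⊆ Ioi 0 from fun z hz => lt_trans hb0 hz),
        integral_const_mul (gs a x), integral_Ioi_rpow_of_lt (by linarith) hb0]
      simp [hD]
      left
      rw [show -1 - α + 1 = -α by ring]
      field_simp
    have hle : ∫ z in Ioi (0:ℝ), H z ≤
        ∫ z in Ioi (0:ℝ), z ^ (-1 - α) * (1 / 2 * (gs a (x + z) + gs a (x - z)) - gs a x) := by
      refine setIntegral_mono_on (hI1.sub hI2) hGi measurableSet_Ioi fun z hz => ?_
      have hz0 : 0 < z := hz
      simp only [hH]
      by_cases hzb : z ≤ b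
      · rw [indicator_of_notMem (fun h => absurd h.1 (by linarith)), indicator_of_notMem (show z ∉ Ioi b from not_lt.2 hzb)]
        rw [sub_zero]
        exact mul_nonneg (by positivity) (gs_bracket ha (by nlinarith) (by nlinarith))
      · rw [indicator_of_mem (show z ∈ Ioi b from not_le.1 hzb)]
        have p1 := (gs_pos ha (x + z)).le
        have p2 := (gs_pos ha (x - z)).le
        have p3 : 0 < z ^ (-1 - α) := by positivity
        by_cases hzx : z ∈ Ioc x (x + 1)
        · rw [indicator_of_mem hzx]
          have q1 : g1 ≤ gs a (x - z) := gs_anti ha (by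
            rw [abs_one, abs_le]; constructor <;> linarith [hzx.1, hzx.2])
          have q2 : (x + 1) ^ (-1 - α) ≤ z ^ (-1 - α) :=
            Real.rpow_le_rpow_of_nonpos hz0 hzx.2 (by linarith)
          have q3 : c1 ≤ 1 / 2 * gs a (x - z) * z ^ (-1 - α) := by
            rw [hc1]; gcongr
          have q4 := mul_nonneg p1 p3.le
          linarith [mul_comm (gs a x) (z ^ (-1 - α)), mul_comm (gs a (x-z)) (z ^ (-1 - α)), mul_comm (gs a (x+z)) (z ^ (-1 - α))]
        · rw [indicator_of_notMem hzx]
          have q4 := mul_nonneg p1 p3.le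
          have q5 := mul_nonneg p2 p3.le
          linarith [mul_comm (gs a x) (z ^ (-1 - α)), mul_comm (gs a (x-z)) (z ^ (-1 - α)), mul_comm (gs a (x+z)) (z ^ (-1 - α))]
    refine le_trans ?_ hle
    rw [hHint, hc1, show -1 - α = -(α + 1) by ring, show x + 1 = 1 + x by ring]
    have hfin : gs a x * D ≤ g1 / 4 * (1 + x) ^ (-(α + 1)) := by
      have h5 := hC' x
      rw [abs_of_pos hx0] at h5
      have h6 : gs a x = A * Real.exp (-(1 / (4 * a) * x ^ 2)) := by
        rw [gs, hA, mul_assoc]; congr 3; ring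
      have h7 : (1 + x) ^ (α + 1) ≤ (1 + x) ^ 3 := by
        rw [← Real.rpow_natCast]
        exact Real.rpow_le_rpow_of_exponent_le (by linarith) (by push_cast; linarith)
      rw [Real.rpow_neg (by positivity), ← div_eq_mul_inv, le_div_iff₀ (by positivity)]
      rw [div_le_iff₀ hg1p] at hx3
      have h8 : gs a x * D * (1 + x) ^ 3 * (1 + x) ≤ g1 / 4 * (1 + x) := by
        calc gs a x * D * (1 + x) ^ 3 * (1 + x)
            = A * D * ((1 + x) ^ 4 * Real.exp (-(1 / (4 * a) * x ^ 2))) := by rw [h6]; ring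
          _ ≤ A * D * C := by gcongr
          _ ≤ _ := by nlinarith
      have h9 := le_of_mul_le_mul_right h8 (by linarith : 0 < 1 + x)
      refine le_trans ?_ h9
      have := (gs_pos ha x).le
      gcongr
    linarith
  have hKpos : 0 < Kc α := by
    rcases (Kc_nonneg α).lt_or_eq with h | h
    · exact h
    · have := key M le_rfl
      rw [← h, zero_mul] at this
      have hM1 : 1 ≤ M := le_max_left _ _
      have : 0 < g1 / 4 * (1 + M) ^ (-(α + 1)) := by positivity
      linarith
  refine ⟨g1 / 4 / Kc α, by positivity, M, le_max_left _ _, fun x hx => ?_⟩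
  have := key |x| hx
  rw [Bf_abs] at this
  rw [Wt, div_mul_eq_mul_div, div_le_iff₀ hKpos]
  linarith

lemma Wt_le_one {α : ℝ} (hα0 : 0 < α) (x : ℝ) : Wt α x ≤ 1 := by
  unfold Wt
  exact Real.rpow_le_one_of_one_le_of_nonpos (by linarith [abs_nonneg x]) (by linarith)

lemma Q_lower {a α : ℝ} (ha : 0 < a) (hα0 : 0 < α) (hα2 : α < 2) :
    ∃ c > 0, ∃ e0 > 0, e0 ≤ 1 ∧ ∀ e ∈ Icc 0 e0, ∀ x : ℝ,
      c * (gs a x + e * Wt α x) ≤ Bf x 0 0 a e α := by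
  obtain ⟨C1, hC1, h1⟩ := Bf_pert ha hα0 hα2 (β := 0) le_rfl
  obtain ⟨C2, hC2, h2⟩ := Bf_pert2 ha hα0 hα2
  obtain ⟨c, hc, M, hM, h3⟩ := Bf_lower ha hα0 hα2
  set m := gs a M with hm
  have hm0 : 0 < m := gs_pos ha M
  refine ⟨min (1 / 4) (min (m / 4) (c / 2)), by positivity,
    min 1 (min (c / (2 * (C2 + 1))) (m / (2 * (C1 + 1)))), by positivity, min_le_left _ _, ?_⟩
  intro e he x
  have he0 : 0 ≤ e := he.1
  have he1 : e ≤ 1 := he.2.trans (min_le_left _ _)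
  have he2 : e ≤ c / (2 * (C2 + 1)) := he.2.trans ((min_le_right _ _).trans (min_le_left _ _))
  have he3 : e ≤ m / (2 * (C1 + 1)) := he.2.trans ((min_le_right _ _).trans (min_le_right _ _))
  rw [le_div_iff₀ (by positivity)] at he2 he3
  set k := min (1 / 4) (min (m / 4) (c / 2)) with hk
  have hk1 : k ≤ 1 / 4 := min_le_left _ _
  have hk2 : k ≤ m / 4 := (min_le_right _ _).trans (min_le_left _ _)
  have hk3 : k ≤ c / 2 := (min_le_right _ _).trans (min_le_right _ _)
  have hk0 : 0 ≤ k := by positivity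
  have hW := Wt_pos α x
  have hW1 := Wt_le_one hα0 x
  have hg := gs_pos ha x
  have heW : 0 ≤ e * Wt α x := by positivity
  rcases le_total M |x| with hx | hx
  · have p1 := (abs_le.1 (h2 e ⟨he0, he1⟩ x)).1
    have p2 := mul_le_mul_of_nonneg_left (h3 x hx) he0
    rw [Bf_zero x ha] at p1
    have p3 : C2 * (e ^ 2 * Wt α x) ≤ c / 2 * (e * Wt α x) := by
      have : C2 * e ≤ c / 2 := by nlinarith
      nlinarith
    nlinarith
  · have p1 := (abs_le.1 (h1 e ⟨he0, he1⟩ x)).1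
    rw [Bf_zero x ha] at p1
    have hgm : m ≤ gs a x := gs_anti ha (by rwa [abs_of_pos (by linarith : 0 < M)])
    have heW1 : e * Wt α x ≤ e := by nlinarith
    have heW2 : e * Wt α x ≤ 1 := by nlinarith
    have p3 : C1 * (e * Wt α x) ≤ m / 2 := by
      have : C1 * e ≤ m / 2 := by nlinarith
      nlinarith
    nlinarith

lemma gs_tail {a α c' : ℝ} (ha : 0 < a) (hα0 : 0 < α) (hα2 : α < 2) (hc' : 0 < c') :
    ∃ C ≥ 0, ∀ L ≥ (1:ℝ), ∀ e : ℝ, c' * Real.exp (-L) ≤ e → ∀ x : ℝ,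
      (1 + x ^ 2) * gs a x ≤ C * (L * (gs a x + e * Wt α x)) ∧
      (1 + x ^ 2) ^ 2 * gs a x ≤ C * (L ^ 2 * (gs a x + e * Wt α x)) := by
  obtain ⟨C, hC, hC'⟩ := poly_gauss 7 (c := 1 / (8 * a)) (by positivity)
  set A := 1 / 2 * Real.sqrt (Real.pi / a) with hA
  have hA0 : 0 < A := by have := Real.pi_pos; positivity
  refine ⟨(1 + 8 * a) ^ 2 + A * C / c', by positivity, ?_⟩
  intro L hL e he x
  have hg := gs_pos ha x
  have hW := Wt_pos α x
  have he0 : 0 < e := lt_of_lt_of_le (by positivity) he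
  have hR : 0 ≤ gs a x + e * Wt α x := by positivity
  have hLL : L ≤ L ^ 2 := by nlinarith
  have hD0 : 0 ≤ A * C / c' := by positivity
  rcases le_or_gt (x ^ 2) (8 * a * L) with hx | hx
  · have h1 : 1 + x ^ 2 ≤ (1 + 8 * a) * L := by nlinarith
    have h2 : gs a x ≤ gs a x + e * Wt α x := by nlinarith
    constructor
    · calc (1 + x ^ 2) * gs a x ≤ ((1 + 8 * a) * L) * (gs a x + e * Wt α x) := by gcongr
        _ = (1 + 8 * a) * (L * (gs a x + e * Wt α x)) := by ring
        _ ≤ _ := mul_le_mul_of_nonneg_right (by nlinarith) (by positivity)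
    · calc (1 + x ^ 2) ^ 2 * gs a x ≤ ((1 + 8 * a) * L) ^ 2 * (gs a x + e * Wt α x) := by gcongr
        _ = (1 + 8 * a) ^ 2 * (L ^ 2 * (gs a x + e * Wt α x)) := by ring
        _ ≤ _ := mul_le_mul_of_nonneg_right (by linarith) (by positivity)
  · have h1 : Real.exp (-(1 / (8 * a) * x ^ 2)) ≤ e / c' := by
      rw [le_div_iff₀ hc']
      refine le_trans ?_ he
      rw [mul_comm]
      gcongr
      rw [div_mul_eq_mul_div, le_div_iff₀ (by positivity)]; linarith
    have h2 : gs a x = A * (Real.exp (-(1 / (8 * a) * x ^ 2)) * Real.exp (-(1 / (8 * a) * x ^ 2))) := by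
      rw [gs, hA, mul_assoc, ← Real.exp_add]; congr 3; field_simp; ring
    have h3 : (1 + x ^ 2) ^ 2 ≤ (1 + |x|) ^ 4 := by
      rw [show (4:ℕ) = 2 * 2 by rfl, pow_mul]
      gcongr
      rw [← sq_abs x]; nlinarith [abs_nonneg x]
    have h4 : 1 ≤ (1 + |x|) ^ 3 * Wt α x := by
      have : (1 + |x|) ^ (α + 1) ≤ (1 + |x|) ^ 3 := by
        rw [← Real.rpow_natCast]
        exact Real.rpow_le_rpow_of_exponent_le (by linarith [abs_nonneg x]) (by push_cast; linarith)
      have hp : 0 < (1 + |x|) ^ (α + 1) := by positivity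
      rw [Wt, Real.rpow_neg (by positivity), ← div_eq_mul_inv, le_div_iff₀ hp]
      linarith
    have h5 : (1 + x ^ 2) ^ 2 * gs a x ≤ A * C / c' * (e * Wt α x) := by
      calc (1 + x ^ 2) ^ 2 * gs a x ≤ (1 + |x|) ^ 4 * gs a x * ((1 + |x|) ^ 3 * Wt α x) := by
            have : (1 + x ^ 2) ^ 2 * gs a x ≤ (1 + |x|) ^ 4 * gs a x := by gcongr
            refine this.trans (le_mul_of_one_le_right (by positivity) h4)
        _ = A * (((1 + |x|) ^ 7 * Real.exp (-(1 / (8 * a) * x ^ 2))) * Real.exp (-(1 / (8 * a) * x ^ 2))) * Wt α x := by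
            rw [h2]; ring
        _ ≤ A * (C * (e / c')) * Wt α x := by
            have := hC' x
            gcongr
        _ = _ := by ring
    have h6 : A * C / c' * (e * Wt α x) ≤ A * C / c' * (gs a x + e * Wt α x) := mul_le_mul_of_nonneg_left (by linarith) (by assumption)
    have h7 : (1 + x ^ 2) * gs a x ≤ (1 + x ^ 2) ^ 2 * gs a x := by
      gcongr; nlinarith [sq_nonneg x]
    have h8 : A * C / c' * (gs a x + e * Wt α x) ≤ A * C / c' * (L * (gs a x + e * Wt α x)) := by
      gcongr; nlinarith
    have h9 : A * C / c' * (L * (gs a x + e * Wt α x)) ≤ A * C / c' * (L ^ 2 * (gs a x + e * Wt α x)) := by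
      gcongr
    have h10 : 0 ≤ (1 + 8 * a) ^ 2 * (L * (gs a x + e * Wt α x)) := by positivity
    have h11 : 0 ≤ (1 + 8 * a) ^ 2 * (L ^ 2 * (gs a x + e * Wt α x)) := by positivity
    constructor
    · rw [add_mul]; linarith
    · rw [add_mul]; linarith

lemma Bf_sigma {a α c' : ℝ} (ha : 0 < a) (hα0 : 0 < α) (hα2 : α < 2) (hc' : 0 < c') :
    ∃ C ≥ 0, ∀ L ≥ (1:ℝ), ∀ e ∈ Icc (0:ℝ) 1, c' * Real.exp (-L) ≤ e → ∀ x : ℝ,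
      |Bf x 2 0 a e α| ≤ C * (L * (gs a x + e * Wt α x)) ∧
      |Bf x 4 0 a e α| ≤ C * (L ^ 2 * (gs a x + e * Wt α x)) := by
  obtain ⟨C1, hC1, h1⟩ := gs_tail ha hα0 hα2 hc'
  obtain ⟨C2, hC2, h2⟩ := Bf_gauss_bound ha hα0 hα2
  obtain ⟨C3, hC3, h3⟩ := Bf_pert ha hα0 hα2 (β := 2) (by norm_num)
  obtain ⟨C4, hC4, h4⟩ := Bf_pert ha hα0 hα2 (β := 4) (by norm_num)
  refine ⟨C2 * C1 + C3 + C4, by positivity, ?_⟩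
  intro L hL e he hLe x
  obtain ⟨p1, p2⟩ := h1 L hL e hLe x
  obtain ⟨q1, q2⟩ := h2 x
  have r3 := h3 e he x
  have r4 := h4 e he x
  have he0 := he.1
  have hg := gs_pos ha x
  have hW := Wt_pos α x
  set R := gs a x + e * Wt α x with hR
  have hR0 : 0 ≤ R := by positivity
  have hLL : L ≤ L ^ 2 := by nlinarith
  have hRW : e * Wt α x ≤ R := by linarith
  have hRL : R ≤ L * R := by nlinarith
  have hRL2 : R ≤ L ^ 2 * R := by nlinarith
  constructor
  · have t := abs_sub_abs_le_abs_sub (Bf x 2 0 a e α) (Bf x 2 0 a 0 α)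
    have s1 : C2 * ((1 + x ^ 2) * gs a x) ≤ C2 * (C1 * (L * R)) := by gcongr
    have s2 : C3 * (e * Wt α x) ≤ C3 * (L * R) := mul_le_mul_of_nonneg_left (by linarith) (by assumption)
    have s3 : 0 ≤ C4 * (L * R) := by positivity
    linarith
  · have t := abs_sub_abs_le_abs_sub (Bf x 4 0 a e α) (Bf x 4 0 a 0 α)
    have s1 : C2 * ((1 + x ^ 2) ^ 2 * gs a x) ≤ C2 * (C1 * (L ^ 2 * R)) := by gcongr
    have s2 : C4 * (e * Wt α x) ≤ C4 * (L ^ 2 * R) := mul_le_mul_of_nonneg_left (by linarith) (by assumption)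
    have s3 : 0 ≤ C3 * (L ^ 2 * R) := by positivity
    linarith

lemma integrable_exp_abs_rpow {α : ℝ} (hα0 : 0 < α) :
    Integrable (fun u : ℝ => Real.exp (-(|u| ^ α))) := by
  have h := (integrable_fun_norm_addHaar (volume : Measure ℝ) (f := fun u : ℝ => Real.exp (-(u ^ α)))).2 (by
    have := integrableOn_rpow_mul_exp_neg_rpow (p := α) (s := 0) (by norm_num) hα0
    simpa using this)
  simpa using h

lemma integrable_gauss : Integrable gauss := by
  have := (integrable_exp_neg_mul_sq (b := 1 / 2) (by norm_num)).const_mul (Real.sqrt (2 * Real.pi))⁻¹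
  refine this.congr (Eventually.of_forall fun s => ?_)
  simp only [gauss]
  congr 2; ring

lemma continuous_gauss : Continuous gauss := by unfold gauss; fun_prop

lemma integral_gauss_cos (v : ℝ) : ∫ s : ℝ, gauss s * Real.cos (v * s) = Real.exp (-(v ^ 2) / 2) := by
  have h := integral_cos_gauss v (a := 1 / 2) (by norm_num)
  have e : ∀ s : ℝ, gauss s * Real.cos (v * s) =
      (Real.sqrt (2 * Real.pi))⁻¹ * (Real.cos (v * s) * Real.exp (-(1 / 2) * s ^ 2)) := by
    intro s
    rw [gauss, show -(s ^ 2) / 2 = -(1 / 2) * s ^ 2 by ring]; ring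
  simp only [e]
  rw [integral_const_mul, h]
  have h1 : Real.pi / (1 / 2) = 2 * Real.pi := by ring
  have h2 : Real.sqrt (2 * Real.pi) ≠ 0 := by have := Real.pi_pos; positivity
  rw [h1, ← mul_assoc, inv_mul_cancel₀ h2, one_mul]
  congr 1; ring

lemma gauss_mul_bdd {f : ℝ → ℝ} (hf : Continuous f) (hb : ∀ s, |f s| ≤ 1) :
    Integrable (fun s => gauss s * f s) := by
  refine Integrable.mul_bdd (c := 1) integrable_gauss hf.aestronglyMeasurable ?_
  exact Eventually.of_forall hb

lemma integral_gauss_cos_shift (A v : ℝ) :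
    ∫ s : ℝ, gauss s * Real.cos (A - v * s) = Real.cos A * Real.exp (-(v ^ 2) / 2) := by
  have i1 : Integrable (fun s => gauss s * Real.cos (A - v * s)) :=
    gauss_mul_bdd (by fun_prop) fun s => Real.abs_cos_le_one _
  have i2 : Integrable (fun s => gauss s * Real.cos (A + v * s)) :=
    gauss_mul_bdd (by fun_prop) fun s => Real.abs_cos_le_one _
  have h1 : ∫ s : ℝ, gauss s * Real.cos (A - v * s) = ∫ s : ℝ, gauss s * Real.cos (A + v * s) := by
    rw [← integral_neg_eq_self]
    congr 1; ext s
    simp [gauss]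
  have h2 : (∫ s : ℝ, gauss s * Real.cos (A - v * s)) + ∫ s : ℝ, gauss s * Real.cos (A + v * s)
      = 2 * Real.cos A * Real.exp (-(v ^ 2) / 2) := by
    rw [← integral_add i1 i2, ← integral_gauss_cos, ← integral_const_mul]
    congr 1; ext s
    rw [Real.cos_add, Real.cos_sub]; ring
  linarith

lemma inner_fourier (y u : ℝ) {w : ℝ} (hw : 0 < w) :
    ∫ z : ℝ, gauss (y - w * z) * Real.cos (z * u) =
      w⁻¹ * (Real.cos (y * (u / w)) * Real.exp (-((u / w) ^ 2) / 2)) := by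
  have h1 : ∀ z : ℝ, gauss (y - w * z) * Real.cos (z * u) =
      (fun t : ℝ => gauss (y - t) * Real.cos (t * (u / w))) (w * z) := by
    intro z
    simp only
    congr 2; field_simp
  simp only [h1]
  rw [Measure.integral_comp_mul_left (fun t : ℝ => gauss (y - t) * Real.cos (t * (u / w))) w]
  rw [abs_of_pos (by positivity), smul_eq_mul, ← integral_gauss_cos_shift,
    ← integral_sub_left_eq_self (fun s => gauss s * Real.cos (y * (u / w) - u / w * s)) volume y]
  congr 2; ext t
  congr 2; ring

lemma fFun_eq (y : ℝ) {w α : ℝ} (hw : 0 < w) (hα0 : 0 < α) :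
    fFun α y w = Real.pi⁻¹ * Bf y 0 0 (1 / 2) (w ^ α) α := by
  have hg : Integrable (fun z : ℝ => gauss (y - w * z)) := by
    have h1 : Integrable (fun t : ℝ => gauss (y - t)) := integrable_gauss.comp_sub_left y
    exact h1.comp_mul_left' hw.ne'
  have hintg : Integrable (Function.uncurry fun z u : ℝ =>
      gauss (y - w * z) * (Real.cos (z * u) * Real.exp (-(|u| ^ α)))) (volume.prod volume) := by
    have h := hg.mul_prod (integrable_exp_abs_rpow hα0)
    have h2 := Integrable.mul_bdd (c := 1) (g := fun p : ℝ × ℝ => Real.cos (p.1 * p.2)) h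
      (by apply Continuous.aestronglyMeasurable; fun_prop)
      (Eventually.of_forall fun p => Real.abs_cos_le_one _)
    refine h2.congr (Eventually.of_forall fun p => ?_)
    simp only [Function.uncurry_def]; ring
  unfold fFun stableDensity
  have e1 : ∀ z : ℝ, gauss (y - w * z) * ((2 * Real.pi)⁻¹ * ∫ u : ℝ, Real.cos (z * u) * Real.exp (-(|u| ^ α)))
      = (2 * Real.pi)⁻¹ * ∫ u : ℝ, gauss (y - w * z) * (Real.cos (z * u) * Real.exp (-(|u| ^ α))) := by
    intro z
    rw [integral_const_mul]; ring
  simp only [e1]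
  rw [integral_const_mul, integral_integral_swap hintg]
  have e2 : ∀ u : ℝ, ∫ z : ℝ, gauss (y - w * z) * (Real.cos (z * u) * Real.exp (-(|u| ^ α))) =
      w⁻¹ * (fun v : ℝ => Real.cos (y * v) * Real.exp (-(v ^ 2) / 2) * Real.exp (-(|w * v| ^ α))) (w⁻¹ * u) := by
    intro u
    have : ∀ z : ℝ, gauss (y - w * z) * (Real.cos (z * u) * Real.exp (-(|u| ^ α))) =
      gauss (y - w * z) * Real.cos (z * u) * Real.exp (-(|u| ^ α)) := by intro z; ring
    simp only [this]
    rw [integral_mul_const, inner_fourier y u hw]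
    rw [mul_inv_cancel_left₀ hw.ne', show w⁻¹ * u = u / w by ring]
    ring
  simp only [e2]
  rw [integral_const_mul, Measure.integral_comp_mul_left
    (fun v : ℝ => Real.cos (y * v) * Real.exp (-(v ^ 2) / 2) * Real.exp (-(|w * v| ^ α))) w⁻¹]
  rw [inv_inv, abs_of_pos hw, smul_eq_mul, inv_mul_cancel_left₀ hw.ne']
  have e3 : ∀ v : ℝ, Real.cos (y * v) * Real.exp (-(v ^ 2) / 2) * Real.exp (-(|w * v| ^ α)) =
      (fun v : ℝ => Real.cos (y * v) * Tf 0 0 (1 / 2) (w ^ α) α v) |v| := by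
    intro v
    have hc : Real.cos (y * |v|) = Real.cos (y * v) := by
      rcases abs_choice v with h | h <;> rw [h]
      rw [mul_neg, Real.cos_neg]
    simp only [Tf, Real.rpow_zero, pow_zero, one_mul, hc]
    rw [abs_mul, abs_of_pos hw, Real.mul_rpow hw.le (abs_nonneg v), mul_assoc, ← Real.exp_add, sq_abs]
    congr 2; ring
  simp only [e3]
  rw [integral_comp_abs (f := fun v : ℝ => Real.cos (y * v) * Tf 0 0 (1 / 2) (w ^ α) α v), ← Bf]
  rw [mul_inv]; ring

lemma Bf_scale (x : ℝ) {s E α : ℝ} (hs : 0 < s) :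
    Bf (x / s) 0 0 (1 / 2) (E / s ^ α) α = s * Bf x 0 0 (s ^ 2 / 2) E α := by
  have h := integral_comp_mul_left_Ioi
    (fun v : ℝ => Real.cos (x / s * v) * Tf 0 0 (1 / 2) (E / s ^ α) α v) 0 hs
  rw [mul_zero, smul_eq_mul, ← Bf] at h
  have e : Bf x 0 0 (s ^ 2 / 2) E α = ∫ u in Ioi (0:ℝ),
      Real.cos (x / s * (s * u)) * Tf 0 0 (1 / 2) (E / s ^ α) α (s * u) := by
    refine setIntegral_congr_fun measurableSet_Ioi fun u hu => ?_
    have hu0 : 0 < u := hu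
    simp only [Tf, Real.rpow_zero, pow_zero, one_mul]
    have hp : s ^ α ≠ 0 := by positivity
    rw [Real.mul_rpow hs.le hu0.le]
    congr 2
    · field_simp
    · field_simp
  rw [e, h]
  field_simp

lemma wn_rpow {n : ℕ} (hn : 0 < n) {σ δ α : ℝ} (hσ : 0 < σ) (hδ : 0 < δ) (hα0 : 0 < α) :
    wn n σ δ α ^ α = δ ^ α * (n : ℝ) ^ (α / 2 - 1) / σ ^ α := by
  have hn0 : (0:ℝ) < n := by exact_mod_cast hn
  rw [wn, Real.div_rpow (by positivity) hσ.le, Real.mul_rpow (by positivity) hδ.le, ← Real.rpow_mul hn0.le]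
  rw [show ((1:ℝ) / 2 - 1 / α) * α = α / 2 - 1 by field_simp]
  ring

def ef (n : ℕ) (δ α : ℝ) : ℝ := δ ^ α * (n : ℝ) ^ (α / 2 - 1)

lemma pdens_eq {n : ℕ} (hn : 0 < n) {θ : Fin 3 → ℝ} (h0 : 0 < θ 0) (h1 : 0 < θ 1) (h2 : 0 < θ 2) (y : ℝ) :
    pdens n θ y = Real.sqrt n * Real.pi⁻¹ *
      Bf (Real.sqrt n * y) 0 0 (θ 0 ^ 2 / 2) (ef n (θ 1) (θ 2)) (θ 2) := by
  have hn0 : (0:ℝ) < n := by exact_mod_cast hn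
  have hw : 0 < wn n (θ 0) (θ 1) (θ 2) := by unfold wn; positivity
  rw [pdens, fFun_eq _ hw h2, wn_rpow hn h0 h1 h2, ← ef, Bf_scale _ h0]
  field_simp

def kap (n : ℕ) (δ : ℝ) : ℝ := Real.log δ + Real.log n / 2

def bb (x : ℝ) (n : ℕ) (r m : ℝ) (k : ℕ) (σ δ α : ℝ) : ℝ :=
  Bf x (r + m * α) k (σ ^ 2 / 2) (ef n δ α) α

lemma ef_pos {n : ℕ} (hn : 0 < n) {δ : ℝ} (hδ : 0 < δ) (α : ℝ) : 0 < ef n δ α := by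
  have hn0 : (0:ℝ) < n := by exact_mod_cast hn
  unfold ef; positivity

lemma hasDerivAt_ef_delta {n : ℕ} {δ : ℝ} (hδ : 0 < δ) (α : ℝ) :
    HasDerivAt (fun t => ef n t α) (α * ef n δ α / δ) δ := by
  have h := (Real.hasDerivAt_rpow_const (x := δ) (p := α) (Or.inl hδ.ne')).mul_const ((n : ℝ) ^ (α / 2 - 1))
  unfold ef
  refine h.congr_deriv ?_
  rw [Real.rpow_sub_one hδ.ne']
  field_simp

lemma hasDerivAt_ef_alpha {n : ℕ} (hn : 0 < n) {δ : ℝ} (hδ : 0 < δ) (α : ℝ) :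
    HasDerivAt (fun t => ef n δ t) (kap n δ * ef n δ α) α := by
  have hn0 : (0:ℝ) < n := by exact_mod_cast hn
  have h1 := (hasDerivAt_id α).const_rpow hδ
  have h2 := (((hasDerivAt_id α).div_const 2).sub_const 1).const_rpow hn0
  have h := h1.mul h2
  unfold ef kap
  refine h.congr_deriv ?_
  simp only [id]
  ring

lemma hasDerivAt_kap {n : ℕ} {δ : ℝ} (hδ : 0 < δ) : HasDerivAt (fun t => kap n t) (1 / δ) δ := by
  have h := (Real.hasDerivAt_log hδ.ne').add_const (Real.log n / 2)
  unfold kap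
  refine h.congr_deriv ?_
  rw [one_div]

section
variable {x : ℝ} {n : ℕ} {σ δ α : ℝ}

lemma hasDerivAt_bb_sigma (hn : 0 < n) (hσ : 0 < σ) (hδ : 0 < δ) (hα0 : 0 < α) (hα2 : α < 2)
    {r m : ℝ} (hr : 0 ≤ r) (hm : 0 ≤ m) (k : ℕ) {r' : ℝ} (hr' : r' = r + 2) :
    HasDerivAt (fun t => bb x n r m k t δ α) (-(σ * bb x n r' m k σ δ α)) σ := by
  have h := hasDerivAt_Bf (a := fun t => t ^ 2 / 2) (e := fun _ => ef n δ α) (α := fun _ => α)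
    (β := fun _ => r + m * α) (a' := fun t => t) (e' := fun _ => 0) (α' := fun _ => 0) (β' := fun _ => 0)
    (t0 := σ) x k
    (Eventually.of_forall fun t => by
      have := ((hasDerivAt_id t).pow 2).div_const 2
      refine this.congr_deriv ?_
      simp)
    (Eventually.of_forall fun t => hasDerivAt_const _ _)
    (Eventually.of_forall fun t => hasDerivAt_const _ _)
    (Eventually.of_forall fun t => hasDerivAt_const _ _)
    continuousAt_id continuousAt_const continuousAt_const continuousAt_const
    (by positivity) (ef_pos hn hδ α).le hα0 hα2 (by positivity)
  unfold bb
  convert h using 1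
  rw [hr', show r + 2 + m * α = r + m * α + 2 by ring]
  ring

lemma hasDerivAt_bb_delta (hn : 0 < n) (hσ : 0 < σ) (hδ : 0 < δ) (hα0 : 0 < α) (hα2 : α < 2)
    {r m : ℝ} (hr : 0 ≤ r) (hm : 0 ≤ m) (k : ℕ) {m' : ℝ} (hm' : m' = m + 1) :
    HasDerivAt (fun t => bb x n r m k σ t α) (-(α * ef n δ α / δ * bb x n r m' k σ δ α)) δ := by
  have h := hasDerivAt_Bf (a := fun _ => σ ^ 2 / 2) (e := fun t => ef n t α) (α := fun _ => α)
    (β := fun _ => r + m * α) (a' := fun t => 0) (e' := fun t => α * ef n t α / t) (α' := fun _ => 0)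
    (β' := fun _ => 0)
    (t0 := δ) x k
    (Eventually.of_forall fun t => hasDerivAt_const _ _)
    ((lt_mem_nhds hδ).mono fun t ht => hasDerivAt_ef_delta ht α)
    (Eventually.of_forall fun t => hasDerivAt_const _ _)
    (Eventually.of_forall fun t => hasDerivAt_const _ _)
    continuousAt_const
    ((continuousAt_const.mul (hasDerivAt_ef_delta hδ α).continuousAt).div continuousAt_id hδ.ne')
    continuousAt_const continuousAt_const
    (by positivity) (ef_pos hn hδ α).le hα0 hα2 (by positivity)
  unfold bb
  convert h using 1
  rw [hm', show r + (m + 1) * α = r + m * α + α by ring]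
  ring

lemma hasDerivAt_bb_alpha (hn : 0 < n) (hσ : 0 < σ) (hδ : 0 < δ) (hα0 : 0 < α) (hα2 : α < 2)
    {r m : ℝ} (hr : 0 ≤ r) (hm : 0 ≤ m) (k : ℕ) {m' : ℝ} (hm' : m' = m + 1) :
    HasDerivAt (fun t => bb x n r m k σ δ t) (m * bb x n r m (k + 1) σ δ α
      - kap n δ * ef n δ α * bb x n r m' k σ δ α - ef n δ α * bb x n r m' (k + 1) σ δ α) α := by
  have h := hasDerivAt_Bf (a := fun _ => σ ^ 2 / 2) (e := fun t => ef n δ t) (α := fun t => t)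
    (β := fun t => r + m * t) (a' := fun t => 0) (e' := fun t => kap n δ * ef n δ t) (α' := fun _ => 1)
    (β' := fun _ => m)
    (t0 := α) x k
    (Eventually.of_forall fun t => hasDerivAt_const _ _)
    (Eventually.of_forall fun t => hasDerivAt_ef_alpha hn hδ t)
    (Eventually.of_forall fun t => hasDerivAt_id _)
    (Eventually.of_forall fun t => by
      have := ((hasDerivAt_id t).const_mul m).const_add r
      refine this.congr_deriv ?_
      simp)
    continuousAt_const
    (continuousAt_const.mul (hasDerivAt_ef_alpha hn hδ α).continuousAt)
    continuousAt_const continuousAt_const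
    (by positivity) (ef_pos hn hδ α).le hα0 hα2 (by positivity)
  unfold bb
  convert h using 1
  rw [hm', show r + (m + 1) * α = r + m * α + α by ring]
  ring
end

/-- first-order derivatives of the Fourier integral -/
def q1 (x : ℝ) (n : ℕ) (j : Fin 3) (θ : Fin 3 → ℝ) : ℝ :=
  ![-(θ 0 * bb x n 2 0 0 (θ 0) (θ 1) (θ 2)),
    -(θ 2 * ef n (θ 1) (θ 2) / θ 1 * bb x n 0 1 0 (θ 0) (θ 1) (θ 2)),
    -(kap n (θ 1) * ef n (θ 1) (θ 2) * bb x n 0 1 0 (θ 0) (θ 1) (θ 2)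
      + ef n (θ 1) (θ 2) * bb x n 0 1 1 (θ 0) (θ 1) (θ 2))] j

/-- second-order derivatives of the Fourier integral -/
def q2 (x : ℝ) (n : ℕ) (i j : Fin 3) (θ : Fin 3 → ℝ) : ℝ :=
  let B := fun (r m : ℝ) (k : ℕ) => bb x n r m k (θ 0) (θ 1) (θ 2)
  let E := ef n (θ 1) (θ 2)
  let K := kap n (θ 1)
  let F := θ 2 * E / θ 1
  (![![-(B 2 0 0 - θ 0 ^ 2 * B 4 0 0),
       F * (θ 0 * B 2 1 0),
       K * E * (θ 0 * B 2 1 0) + E * (θ 0 * B 2 1 1)],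
     ![θ 0 * (F * B 2 1 0),
       -(θ 2 * (θ 2 - 1) * E / θ 1 ^ 2 * B 0 1 0 - F * (F * B 0 2 0)),
       -((E / θ 1 + K * F) * B 0 1 0 - K * E * (F * B 0 2 0) + F * B 0 1 1 - E * (F * B 0 2 1))],
     ![θ 0 * (K * E * B 2 1 0 + E * B 2 1 1),
       -((E + θ 2 * (K * E)) / θ 1 * B 0 1 0 + F * (B 0 1 1 - K * E * B 0 2 0 - E * B 0 2 1)),
       -(K * (K * E) * B 0 1 0 + K * E * (B 0 1 1 - K * E * B 0 2 0 - E * B 0 2 1)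
         + K * E * B 0 1 1 + E * (B 0 1 2 - K * E * B 0 2 1 - E * B 0 2 2))]] : Fin 3 → Fin 3 → ℝ) i j

def Uset : Set (Fin 3 → ℝ) := {θ | 0 < θ 0 ∧ 0 < θ 1 ∧ 0 < θ 2 ∧ θ 2 < 2}

lemma isOpen_Uset : IsOpen Uset := by
  unfold Uset
  refine (isOpen_lt continuous_const (continuous_apply 0)).inter ?_
  refine (isOpen_lt continuous_const (continuous_apply 1)).inter ?_
  exact (isOpen_lt continuous_const (continuous_apply 2)).inter (isOpen_lt (continuous_apply 2) continuous_const)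

lemma hasDerivAt_Q (x : ℝ) {n : ℕ} (hn : 0 < n) (j : Fin 3) (θ : Fin 3 → ℝ) (hθ : θ ∈ Uset) :
    HasDerivAt (fun t => bb x n 0 0 0 (Function.update θ j t 0) (Function.update θ j t 1)
      (Function.update θ j t 2)) (q1 x n j θ) (θ j) := by
  obtain ⟨h0, h1, h2, h3⟩ := hθ
  fin_cases j
  · have h := hasDerivAt_bb_sigma (x := x) hn h0 h1 h2 h3 (r := 0) (m := 0) le_rfl le_rfl 0 (r' := 2) (by norm_num)
    simpa [q1] using h
  · have h := hasDerivAt_bb_delta (x := x) hn h0 h1 h2 h3 (r := 0) (m := 0) le_rfl le_rfl 0 (m' := 1) (by norm_num)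
    simpa [q1] using h
  · have h := hasDerivAt_bb_alpha (x := x) hn h0 h1 h2 h3 (r := 0) (m := 0) le_rfl le_rfl 0 (m' := 1) (by norm_num)
    refine (h.congr_deriv ?_).congr_of_eventuallyEq (Eventually.of_forall fun t => ?_)
    · simp [q1]; ring
    · simp

lemma hasDerivAt_q1_0 (x : ℝ) {n : ℕ} (hn : 0 < n) (i : Fin 3) (θ : Fin 3 → ℝ) (hθ : θ ∈ Uset) :
    HasDerivAt (fun t => q1 x n 0 (Function.update θ i t)) (q2 x n i 0 θ) (θ i) := by
  obtain ⟨h0, h1, h2, h3⟩ := hθ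
  fin_cases i
  · have h := hasDerivAt_bb_sigma (x := x) hn h0 h1 h2 h3 (r := 2) (m := 0) (by norm_num) le_rfl 0 (r' := 4) (by norm_num)
    have H := ((hasDerivAt_id (θ 0)).mul h).neg
    refine (H.congr_deriv ?_).congr_of_eventuallyEq (Eventually.of_forall fun t => ?_)
    · simp [q2]; ring
    · simp [q1]
  · have h := hasDerivAt_bb_delta (x := x) hn h0 h1 h2 h3 (r := 2) (m := 0) (by norm_num) le_rfl 0 (m' := 1) (by norm_num)
    have H := (h.const_mul (θ 0)).neg
    refine (H.congr_deriv ?_).congr_of_eventuallyEq (Eventually.of_forall fun t => ?_)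
    · simp [q2]
    · simp [q1]
  · have h := hasDerivAt_bb_alpha (x := x) hn h0 h1 h2 h3 (r := 2) (m := 0) (by norm_num) le_rfl 0 (m' := 1) (by norm_num)
    have H := (h.const_mul (θ 0)).neg
    refine (H.congr_deriv ?_).congr_of_eventuallyEq (Eventually.of_forall fun t => ?_)
    · simp [q2]; ring
    · simp [q1]

lemma hasDerivAt_q1_1 (x : ℝ) {n : ℕ} (hn : 0 < n) (i : Fin 3) (θ : Fin 3 → ℝ) (hθ : θ ∈ Uset) :
    HasDerivAt (fun t => q1 x n 1 (Function.update θ i t)) (q2 x n i 1 θ) (θ i) := by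
  obtain ⟨h0, h1, h2, h3⟩ := hθ
  fin_cases i
  · have h := hasDerivAt_bb_sigma (x := x) hn h0 h1 h2 h3 (r := 0) (m := 1) le_rfl (by norm_num) 0 (r' := 2) (by norm_num)
    have H := (h.const_mul (θ 2 * ef n (θ 1) (θ 2) / θ 1)).neg
    refine (H.congr_deriv ?_).congr_of_eventuallyEq (Eventually.of_forall fun t => ?_)
    · simp [q2]
    · simp [q1]
  · have h := hasDerivAt_bb_delta (x := x) hn h0 h1 h2 h3 (r := 0) (m := 1) le_rfl (by norm_num) 0 (m' := 2) (by norm_num)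
    have H := ((((hasDerivAt_ef_delta (n := n) h1 (θ 2)).const_mul (θ 2)).div (hasDerivAt_id (θ 1)) h1.ne').mul h).neg
    refine (H.congr_deriv ?_).congr_of_eventuallyEq (Eventually.of_forall fun t => ?_)
    · simp [q2]; try (field_simp; try ring)
    · simp [q1]
  · have h := hasDerivAt_bb_alpha (x := x) hn h0 h1 h2 h3 (r := 0) (m := 1) le_rfl (by norm_num) 0 (m' := 2) (by norm_num)
    have H := ((((hasDerivAt_id (θ 2)).mul (hasDerivAt_ef_alpha hn h1 (θ 2))).div_const (θ 1)).mul h).neg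
    refine (H.congr_deriv ?_).congr_of_eventuallyEq (Eventually.of_forall fun t => ?_)
    · simp [q2]
    · simp [q1]

lemma hasDerivAt_q1_2 (x : ℝ) {n : ℕ} (hn : 0 < n) (i : Fin 3) (θ : Fin 3 → ℝ) (hθ : θ ∈ Uset) :
    HasDerivAt (fun t => q1 x n 2 (Function.update θ i t)) (q2 x n i 2 θ) (θ i) := by
  obtain ⟨h0, h1, h2, h3⟩ := hθ
  fin_cases i
  · have h := hasDerivAt_bb_sigma (x := x) hn h0 h1 h2 h3 (r := 0) (m := 1) le_rfl (by norm_num) 0 (r' := 2) (by norm_num)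
    have h' := hasDerivAt_bb_sigma (x := x) hn h0 h1 h2 h3 (r := 0) (m := 1) le_rfl (by norm_num) 1 (r' := 2) (by norm_num)
    have H := ((h.const_mul (kap n (θ 1) * ef n (θ 1) (θ 2))).add (h'.const_mul (ef n (θ 1) (θ 2)))).neg
    refine (H.congr_deriv ?_).congr_of_eventuallyEq (Eventually.of_forall fun t => ?_)
    · simp [q2]; ring
    · simp [q1]
  · have h := hasDerivAt_bb_delta (x := x) hn h0 h1 h2 h3 (r := 0) (m := 1) le_rfl (by norm_num) 0 (m' := 2) (by norm_num)
    have h' := hasDerivAt_bb_delta (x := x) hn h0 h1 h2 h3 (r := 0) (m := 1) le_rfl (by norm_num) 1 (m' := 2) (by norm_num)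
    have hE := hasDerivAt_ef_delta (n := n) h1 (θ 2)
    have H := ((((hasDerivAt_kap (n := n) h1).mul hE).mul h).add (hE.mul h')).neg
    refine (H.congr_deriv ?_).congr_of_eventuallyEq (Eventually.of_forall fun t => ?_)
    · simp [q2]; ring
    · simp [q1]
  · have h := hasDerivAt_bb_alpha (x := x) hn h0 h1 h2 h3 (r := 0) (m := 1) le_rfl (by norm_num) 0 (m' := 2) (by norm_num)
    have h' := hasDerivAt_bb_alpha (x := x) hn h0 h1 h2 h3 (r := 0) (m := 1) le_rfl (by norm_num) 1 (m' := 2) (by norm_num)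
    have hE := hasDerivAt_ef_alpha hn h1 (θ 2)
    have H := (((hE.const_mul (kap n (θ 1))).mul h).add (hE.mul h')).neg
    refine (H.congr_deriv ?_).congr_of_eventuallyEq (Eventually.of_forall fun t => ?_)
    · simp [q2]; ring
    · simp [q1]

lemma second_log (P Q : (Fin 3 → ℝ) → ℝ) (U : Set (Fin 3 → ℝ)) (hU : IsOpen U)
    (q : Fin 3 → (Fin 3 → ℝ) → ℝ) (qq : Fin 3 → Fin 3 → (Fin 3 → ℝ) → ℝ) (c : ℝ) (hc : 0 < c)
    (hP : ∀ θ ∈ U, P θ = c * Q θ)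
    (hq : ∀ j, ∀ θ ∈ U, HasDerivAt (fun t => Q (Function.update θ j t)) (q j θ) (θ j))
    (hqq : ∀ i j, ∀ θ ∈ U, HasDerivAt (fun t => q j (Function.update θ i t)) (qq i j θ) (θ i))
    (θ : Fin 3 → ℝ) (hθ : θ ∈ U) (hQ : 0 < Q θ) (i j : Fin 3) :
    pderiv i (fun θ' => pderiv j (fun θ'' => Real.log (P θ'')) θ') θ
      = qq i j θ / Q θ - q i θ * q j θ / Q θ ^ 2 := by
  have ev : ∀ θ ∈ U, ∀ j, ∀ᶠ t in 𝓝 (θ j), Function.update θ j t ∈ U := by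
    intro θ hθ j
    have hc : ContinuousAt (fun t => Function.update θ j t) (θ j) := by
      exact (continuous_const.update j continuous_id).continuousAt
    refine hc.eventually_mem (hU.mem_nhds ?_)
    rwa [Function.update_eq_self]
  have first : ∀ θ ∈ U, 0 < Q θ → ∀ j, pderiv j (fun θ'' => Real.log (P θ'')) θ = q j θ / Q θ := by
    intro θ hθ hQ j
    have h1 := (hq j θ hθ).const_mul c
    have h2 := h1.log (by rw [Function.update_eq_self]; positivity)
    rw [Function.update_eq_self] at h2
    have h3 : HasDerivAt (fun t => Real.log (P (Function.update θ j t))) (q j θ / Q θ) (θ j) := by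
      refine (h2.congr_deriv ?_).congr_of_eventuallyEq ?_
      · field_simp
      · filter_upwards [ev θ hθ j] with t ht
        rw [hP _ ht]
    exact h3.deriv
  have hQe : ∀ᶠ t in 𝓝 (θ i), 0 < Q (Function.update θ i t) := by
    refine (hq i θ hθ).continuousAt.eventually (lt_mem_nhds ?_)
    simpa using hQ
  have h1 := (hqq i j θ hθ).div (hq i θ hθ) (by rw [Function.update_eq_self]; exact hQ.ne')
  rw [Function.update_eq_self] at h1
  have h2 : HasDerivAt (fun t => pderiv j (fun θ'' => Real.log (P θ'')) (Function.update θ i t))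
      (qq i j θ / Q θ - q i θ * q j θ / Q θ ^ 2) (θ i) := by
    refine (h1.congr_deriv ?_).congr_of_eventuallyEq ?_
    · field_simp
    · filter_upwards [ev θ hθ i, hQe] with t ht ht2
      rw [first _ ht ht2]; rfl
  exact h2.deriv

lemma pdens_second {n : ℕ} (hn : 0 < n) (y : ℝ) {θ : Fin 3 → ℝ} (hθ : θ ∈ Uset)
    (hQ : 0 < bb (Real.sqrt n * y) n 0 0 0 (θ 0) (θ 1) (θ 2)) (i j : Fin 3) :
    pderiv i (fun θ' => pderiv j (fun θ'' => Real.log (pdens n θ'' y)) θ') θ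
      = q2 (Real.sqrt n * y) n i j θ / bb (Real.sqrt n * y) n 0 0 0 (θ 0) (θ 1) (θ 2)
        - q1 (Real.sqrt n * y) n i θ * q1 (Real.sqrt n * y) n j θ
          / bb (Real.sqrt n * y) n 0 0 0 (θ 0) (θ 1) (θ 2) ^ 2 := by
  have hn0 : (0:ℝ) < n := by exact_mod_cast hn
  have hpi := Real.pi_pos
  refine second_log (fun θ => pdens n θ y)
    (fun θ => bb (Real.sqrt n * y) n 0 0 0 (θ 0) (θ 1) (θ 2)) Uset isOpen_Uset
    (q1 (Real.sqrt n * y) n) (q2 (Real.sqrt n * y) n) (Real.sqrt n * Real.pi⁻¹) (by positivity)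
    ?_ ?_ ?_ θ hθ hQ i j
  · intro θ hθ
    rw [pdens_eq hn hθ.1 hθ.2.1 hθ.2.2.1, bb]
    congr 2; ring
  · intro j θ hθ
    exact hasDerivAt_Q _ hn j θ hθ
  · intro i j θ hθ
    fin_cases j
    · exact hasDerivAt_q1_0 _ hn i θ hθ
    · exact hasDerivAt_q1_1 _ hn i θ hθ
    · exact hasDerivAt_q1_2 _ hn i θ hθ

def Bd (D L : ℝ) (p q : ℕ) (c : ℝ) : Prop := |c| ≤ D ^ p * L ^ q

lemma Bd.mul {D L : ℝ} {p q p' q' : ℕ} {c c' : ℝ} (h : Bd D L p q c) (h' : Bd D L p' q' c') :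
    Bd D L (p + p') (q + q') (c * c') := by
  unfold Bd at *
  rw [abs_mul]
  calc |c| * |c'| ≤ (D ^ p * L ^ q) * (D ^ p' * L ^ q') :=
        mul_le_mul h h' (abs_nonneg _) ((abs_nonneg _).trans h)
    _ = _ := by ring

lemma Bd.term {D L : ℝ} {p q : ℕ} {c B X : ℝ} (h : Bd D L p q c) (hD : 1 ≤ D) (hL : 1 ≤ L)
    {p' q' : ℕ} (hp : p ≤ p') (hq : q ≤ q') (hB : |B| ≤ X) : |c * B| ≤ D ^ p' * L ^ q' * X := by
  unfold Bd at h
  rw [abs_mul]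
  have h1 : D ^ p ≤ D ^ p' := pow_le_pow_right₀ hD hp
  have h2 : L ^ q ≤ L ^ q' := pow_le_pow_right₀ hL hq
  have h3 : D ^ p * L ^ q ≤ D ^ p' * L ^ q' := by gcongr
  exact mul_le_mul (h.trans h3) hB (abs_nonneg _) (by positivity)

lemma Bf_upper_all {a α : ℝ} (ha : 0 < a) (hα0 : 0 < α) (hα2 : α < 2) :
    ∃ C ≥ (0:ℝ), ∀ e ∈ Icc (0:ℝ) 1, ∀ x : ℝ,
      (|Bf x (0 + 1 * α) 0 a e α| ≤ C * (Lg x * Wt α x) ∧ |Bf x (0 + 1 * α) 1 a e α| ≤ C * (Lg x * Wt α x)) ∧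
      (∀ k : ℕ, k ≤ 2 → |Bf x (0 + 1 * α) k a e α| ≤ C * (Lg x ^ 2 * Wt α x) ∧
        |Bf x (2 + 1 * α) k a e α| ≤ C * (Lg x ^ 2 * Wt α x) ∧
        |Bf x (0 + 2 * α) k a e α| ≤ C * (Lg x ^ 2 * Wt α x)) := by
  choose C1 hC1 h1 using fun k => Bf_upper ha hα0 hα2 (β := 0 + 1 * α) (by linarith) k
  choose C2 hC2 h2 using fun k => Bf_upper ha hα0 hα2 (β := 2 + 1 * α) (by linarith) k
  choose C3 hC3 h3 using fun k => Bf_upper ha hα0 hα2 (β := 0 + 2 * α) (by linarith) k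
  have n1 : ∀ k, 0 ≤ C1 k := hC1
  have n2 : ∀ k, 0 ≤ C2 k := hC2
  have n3 : ∀ k, 0 ≤ C3 k := hC3
  set S := ∑ k ∈ Finset.range 3, (C1 k + C2 k + C3 k) with hS
  have hle : ∀ k ≤ 2, C1 k + C2 k + C3 k ≤ S := by
    intro k hk
    exact Finset.single_le_sum (f := fun k => C1 k + C2 k + C3 k)
      (fun i _ => add_nonneg (add_nonneg (n1 i) (n2 i)) (n3 i)) (by simp; omega)
  have hS0 : 0 ≤ S := le_trans (add_nonneg (add_nonneg (n1 0) (n2 0)) (n3 0)) (hle 0 (by norm_num))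
  refine ⟨S, hS0, fun e he x => ?_⟩
  have hl := one_le_Lg x
  have hW := (Wt_pos α x).le
  have key : ∀ (k q : ℕ) (D : ℝ), k ≤ q → 0 ≤ D → D ≤ S → ∀ b : ℝ, |b| ≤ D * (Lg x ^ k * Wt α x) →
      |b| ≤ S * (Lg x ^ q * Wt α x) := by
    intro k q D hk hD hDS b hb
    refine hb.trans ?_
    have : Lg x ^ k ≤ Lg x ^ q := pow_le_pow_right₀ hl hk
    gcongr
  refine ⟨⟨?_, ?_⟩, fun k hk => ⟨?_, ?_, ?_⟩⟩
  · have := key 0 1 (C1 0) (by norm_num) (n1 0) (by linarith [hle 0 (by norm_num), n2 0, n3 0]) _ (h1 0 e he x)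
    simpa using this
  · have := key 1 1 (C1 1) (by norm_num) (n1 1) (by linarith [hle 1 (by norm_num), n2 1, n3 1]) _ (h1 1 e he x)
    simpa using this
  · exact key k 2 (C1 k) hk (n1 k) (by linarith [hle k hk, n2 k, n3 k]) _ (h1 k e he x)
  · exact key k 2 (C2 k) hk (n2 k) (by linarith [hle k hk, n1 k, n3 k]) _ (h2 k e he x)
  · exact key k 2 (C3 k) hk (n3 k) (by linarith [hle k hk, n1 k, n2 k]) _ (h3 k e he x)

lemma ef_tendsto (δ : ℝ) {α : ℝ} (hα2 : α < 2) :
    Tendsto (fun n : ℕ => ef n δ α) atTop (𝓝 0) := by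
  have h := (tendsto_rpow_neg_atTop (y := 1 - α / 2) (by linarith)).comp tendsto_natCast_atTop_atTop
  have h2 := h.const_mul (δ ^ α)
  rw [mul_zero] at h2
  refine h2.congr fun n => ?_
  simp only [ef, Function.comp]
  congr 2; ring

lemma ef_lower {n : ℕ} (hn : 0 < n) {δ α : ℝ} (hδ : 0 < δ) (hα0 : 0 < α) :
    δ ^ α * Real.exp (-Real.log n) ≤ ef n δ α := by
  have hn0 : (0:ℝ) < n := by exact_mod_cast hn
  have hn1 : (1:ℝ) ≤ n := by exact_mod_cast hn
  rw [ef, Real.exp_neg, Real.exp_log hn0, ← Real.rpow_neg_one]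
  gcongr
  linarith

section
variable {x : ℝ} {n : ℕ} {σ δ α D L X X1 : ℝ}

lemma q2_bound (hD : 1 ≤ D) (hL : 1 ≤ L) (hσ : |σ| ≤ D) (hf : |α / δ| ≤ D) (hg : |1 / δ| ≤ D)
    (hα : |α - 1| ≤ D) (hδ : δ ≠ 0)
    (hK : |kap n δ| ≤ D * L) (hE : 0 < ef n δ α) (hE1 : ef n δ α ≤ 1)
    (hB : ∀ k : ℕ, k ≤ 2 → |bb x n 0 1 k σ δ α| ≤ X ∧ |bb x n 2 1 k σ δ α| ≤ X ∧ |bb x n 0 2 k σ δ α| ≤ X)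
    (i j : Fin 3) (hij : ¬ (i = 0 ∧ j = 0)) :
    |q2 x n i j ![σ, δ, α]| ≤ 8 * (ef n δ α * (D ^ 4 * L ^ 2 * X)) := by
  set K := kap n δ with hKdef
  set E := ef n δ α with hEdef
  set f := α / δ with hfdef
  set g := 1 / δ with hgdef
  have b1 : Bd D L 0 0 1 := by simp [Bd]
  have bK : Bd D L 1 1 K := by simpa [Bd] using hK
  have bE : Bd D L 0 0 E := by simp [Bd, abs_of_pos hE, hE1]
  have bf : Bd D L 1 0 f := by simpa [Bd] using hf
  have bg : Bd D L 1 0 g := by simpa [Bd] using hg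
  have bs : Bd D L 1 0 σ := by simpa [Bd] using hσ
  have ba : Bd D L 1 0 (α - 1) := by simpa [Bd] using hα
  have T : ∀ {p q : ℕ} {c B : ℝ}, Bd D L p q c → p ≤ 4 → q ≤ 2 → |B| ≤ X → |c * B| ≤ D ^ 4 * L ^ 2 * X :=
    fun h hp hq hB => h.term hD hL hp hq hB
  obtain ⟨u0, v0, w0⟩ := hB 0 (by norm_num)
  obtain ⟨u1, v1, w1⟩ := hB 1 (by norm_num)
  obtain ⟨u2, v2, w2⟩ := hB 2 (by norm_num)
  set Y := D ^ 4 * L ^ 2 * X with hY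
  have fin : ∀ S q : ℝ, q = E * S → |S| ≤ 8 * Y → |q| ≤ 8 * (E * Y) := by
    intro S q hq hS
    rw [hq, abs_mul, abs_of_pos hE]
    nlinarith
  have hY0 : 0 ≤ Y := (abs_nonneg _).trans (T b1 (by norm_num) (by norm_num) u0)
  have r01 : |f * σ * bb x n 2 1 0 σ δ α| ≤ 8 * Y := by
    have := T (bf.mul bs) (by norm_num) (by norm_num) v0
    linarith
  have r02 : |K * σ * bb x n 2 1 0 σ δ α + σ * bb x n 2 1 1 σ δ α| ≤ 8 * Y := by
    have t1 := abs_le.1 (T (bK.mul bs) (by norm_num) (by norm_num) v0)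
    have t2 := abs_le.1 (T bs (by norm_num) (by norm_num) v1)
    rw [abs_le]; constructor <;> linarith [t1.1, t1.2, t2.1, t2.2]
  have r11 : |-(f * (α - 1) * g * bb x n 0 1 0 σ δ α - f * f * E * bb x n 0 2 0 σ δ α)| ≤ 8 * Y := by
    have t1 := abs_le.1 (T ((bf.mul ba).mul bg) (by norm_num) (by norm_num) u0)
    have t2 := abs_le.1 (T ((bf.mul bf).mul bE) (by norm_num) (by norm_num) w0)
    rw [abs_le]; constructor <;> linarith [t1.1, t1.2, t2.1, t2.2]
  have r12 : |-(g * bb x n 0 1 0 σ δ α + K * f * bb x n 0 1 0 σ δ α - K * E * f * bb x n 0 2 0 σ δ α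
      + f * bb x n 0 1 1 σ δ α - E * f * bb x n 0 2 1 σ δ α)| ≤ 8 * Y := by
    have t1 := abs_le.1 (T bg (by norm_num) (by norm_num) u0)
    have t2 := abs_le.1 (T (bK.mul bf) (by norm_num) (by norm_num) u0)
    have t3 := abs_le.1 (T ((bK.mul bE).mul bf) (by norm_num) (by norm_num) w0)
    have t4 := abs_le.1 (T bf (by norm_num) (by norm_num) u1)
    have t5 := abs_le.1 (T (bE.mul bf) (by norm_num) (by norm_num) w1)
    rw [abs_le]
    constructor <;> linarith [t1.1, t1.2, t2.1, t2.2, t3.1, t3.2, t4.1, t4.2, t5.1, t5.2]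
  have r22 : |-(K * K * bb x n 0 1 0 σ δ α + 2 * (K * bb x n 0 1 1 σ δ α)
      - K * K * E * bb x n 0 2 0 σ δ α - 2 * (K * E * bb x n 0 2 1 σ δ α)
      + 1 * bb x n 0 1 2 σ δ α - E * bb x n 0 2 2 σ δ α)| ≤ 8 * Y := by
    have t1 := abs_le.1 (T (bK.mul bK) (by norm_num) (by norm_num) u0)
    have t2 := abs_le.1 (T bK (by norm_num) (by norm_num) u1)
    have t3 := abs_le.1 (T ((bK.mul bK).mul bE) (by norm_num) (by norm_num) w0)
    have t4 := abs_le.1 (T (bK.mul bE) (by norm_num) (by norm_num) w1)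
    have t5 := abs_le.1 (T b1 (by norm_num) (by norm_num) u2)
    have t6 := abs_le.1 (T bE (by norm_num) (by norm_num) w2)
    rw [abs_le]
    constructor <;> linarith [t1.1, t1.2, t2.1, t2.2, t3.1, t3.2, t4.1, t4.2, t5.1, t5.2, t6.1, t6.2]
  fin_cases i <;> fin_cases j
  · simp at hij
  · refine fin _ _ ?_ r01
    simp [q2, ← hEdef, ← hKdef, hfdef]; ring
  · refine fin _ _ ?_ r02
    simp [q2, ← hEdef, ← hKdef]; ring
  · refine fin _ _ ?_ r01
    simp [q2, ← hEdef, ← hKdef, hfdef]; ring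
  · refine fin _ _ ?_ r11
    simp [q2, ← hEdef, ← hKdef, hfdef, hgdef]; ring
  · refine fin _ _ ?_ r12
    simp [q2, ← hEdef, ← hKdef, hfdef, hgdef]; ring
  · refine fin _ _ ?_ r02
    simp [q2, ← hEdef, ← hKdef]; ring
  · refine fin _ _ ?_ r12
    simp [q2, ← hEdef, ← hKdef, hfdef, hgdef]; ring
  · refine fin _ _ ?_ r22
    simp [q2, ← hEdef, ← hKdef]; ring

lemma q1_bound (hD : 1 ≤ D) (hL : 1 ≤ L) (hf : |α / δ| ≤ D)
    (hK : |kap n δ| ≤ D * L) (hE : 0 < ef n δ α)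
    (hB0 : |bb x n 0 1 0 σ δ α| ≤ X1) (hB1 : |bb x n 0 1 1 σ δ α| ≤ X1)
    (j : Fin 3) (hj : j ≠ 0) :
    |q1 x n j ![σ, δ, α]| ≤ 2 * (ef n δ α * (D * L * X1)) := by
  have b1 : Bd D L 0 0 1 := by simp [Bd]
  have bK : Bd D L 1 1 (kap n δ) := by simpa [Bd] using hK
  have bf : Bd D L 1 0 (α / δ) := by simpa [Bd] using hf
  have t1 := bf.term hD hL (p' := 1) (q' := 1) (by norm_num) (by norm_num) hB0
  have t2 := bK.term hD hL (p' := 1) (q' := 1) (by norm_num) (by norm_num) hB0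
  have t3 := b1.term hD hL (p' := 1) (q' := 1) (by norm_num) (by norm_num) hB1
  rw [pow_one, pow_one] at t1 t2 t3
  have fin : ∀ S q : ℝ, q = ef n δ α * S → |S| ≤ 2 * (D * L * X1) → |q| ≤ 2 * (ef n δ α * (D * L * X1)) := by
    intro S q hq hS
    rw [hq, abs_mul, abs_of_pos hE]
    nlinarith
  have hY0 : 0 ≤ D * L * X1 := (abs_nonneg _).trans t1
  fin_cases j
  · simp at hj
  · refine fin (-(α / δ * bb x n 0 1 0 σ δ α)) _ ?_ (by rw [abs_neg]; linarith)
    simp [q1]; ring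
  · refine fin (-(kap n δ * bb x n 0 1 0 σ δ α + 1 * bb x n 0 1 1 σ δ α)) _ ?_ (by
      rw [abs_neg]; exact (abs_add_le _ _).trans (by linarith))
    simp [q1]; ring
end

set_option maxHeartbeats 800000 in
lemma main_bounds {σ δ α : ℝ} (hσ : 0 < σ) (hδ : 0 < δ) (hα0 : 0 < α) (hα2 : α < 2) :
    ∃ C > (0:ℝ), ∃ c > (0:ℝ), ∀ᶠ n : ℕ in atTop, 0 < n ∧ 1 ≤ Real.log n ∧ 0 < ef n δ α ∧ ∀ x : ℝ,
      c * (gs (σ ^ 2 / 2) x + ef n δ α * Wt α x) ≤ bb x n 0 0 0 σ δ α ∧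
      |q1 x n 0 ![σ, δ, α]| ≤ C * (Real.log n * bb x n 0 0 0 σ δ α) ∧
      |q2 x n 0 0 ![σ, δ, α]| ≤ C * (Real.log n ^ 2 * bb x n 0 0 0 σ δ α) ∧
      (∀ j : Fin 3, j ≠ 0 → |q1 x n j ![σ, δ, α]| ≤ C * (Real.log n * (ef n δ α * (Lg x * Wt α x)))) ∧
      (∀ i j : Fin 3, ¬ (i = 0 ∧ j = 0) →
        |q2 x n i j ![σ, δ, α]| ≤ C * (Real.log n ^ 2 * (ef n δ α * (Lg x ^ 2 * Wt α x)))) := by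
  have ha : 0 < σ ^ 2 / 2 := by positivity
  obtain ⟨c, hc, e0, he0, he01, hlow⟩ := Q_lower ha hα0 hα2
  obtain ⟨C1, hC1, hs⟩ := Bf_sigma ha hα0 hα2 (c' := δ ^ α) (by positivity)
  obtain ⟨C2, hC2, hu⟩ := Bf_upper_all ha hα0 hα2
  set D := 1 + |σ| + |α / δ| + |1 / δ| + |α - 1| + |Real.log δ| with hD
  have a1 := abs_nonneg σ
  have a2 := abs_nonneg (α / δ)
  have a3 := abs_nonneg (1 / δ)
  have a4 := abs_nonneg (α - 1)
  have a5 := abs_nonneg (Real.log δ)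
  have hD1 : 1 ≤ D := by linarith
  have hσD : σ ≤ D := by linarith [le_abs_self σ]
  refine ⟨1 + (1 + D ^ 2) * (C1 / c) + 2 * (D * C2) + 8 * (D ^ 4 * C2), by positivity, c, hc, ?_⟩
  have ev1 : ∀ᶠ n : ℕ in atTop, 1 ≤ Real.log n :=
    (Real.tendsto_log_atTop.comp tendsto_natCast_atTop_atTop).eventually_ge_atTop 1
  have ev2 : ∀ᶠ n : ℕ in atTop, ef n δ α < e0 := (ef_tendsto δ hα2).eventually (gt_mem_nhds he0)
  filter_upwards [ev1, ev2, eventually_gt_atTop 0] with n hL he hn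
  have hE := ef_pos hn hδ α
  have hE1 : ef n δ α ≤ 1 := he.le.trans he01
  refine ⟨hn, hL, hE, fun x => ?_⟩
  set L := Real.log n with hLdef
  set E := ef n δ α with hEdef
  have hQ : c * (gs (σ ^ 2 / 2) x + E * Wt α x) ≤ bb x n 0 0 0 σ δ α := by
    have := hlow E ⟨hE.le, he.le⟩ x
    simpa [bb] using this
  set Q := bb x n 0 0 0 σ δ α with hQdef
  set R := gs (σ ^ 2 / 2) x + E * Wt α x with hR
  have hW := Wt_pos α x
  have hl := one_le_Lg x
  have hR0 : 0 < R := by have := gs_pos ha x; positivity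
  have hRQ : R ≤ Q / c := by rw [le_div_iff₀ hc]; linarith
  have hQ0 : 0 < Q := lt_of_lt_of_le (by positivity) hQ
  obtain ⟨s2, s4⟩ := hs L hL E ⟨hE.le, hE1⟩ (by rw [hEdef]; exact ef_lower hn hδ hα0) x
  obtain ⟨⟨u0, u1⟩, hB⟩ := hu E ⟨hE.le, hE1⟩ x
  have hb2 : bb x n 2 0 0 σ δ α = Bf x 2 0 (σ ^ 2 / 2) E α := by rw [bb]; congr 1; ring
  have hb4 : bb x n 4 0 0 σ δ α = Bf x 4 0 (σ ^ 2 / 2) E α := by rw [bb]; congr 1; ring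
  have hK : |kap n δ| ≤ D * L := by
    rw [kap, ← hLdef]
    refine (abs_add_le _ _).trans ?_
    rw [abs_of_nonneg (by linarith : 0 ≤ L / 2)]
    have : |Real.log δ| + 1 / 2 ≤ D := by linarith
    have h3 : (|Real.log δ| + 1 / 2) * L ≤ D * L := by gcongr
    have h4 : |Real.log δ| * 1 ≤ |Real.log δ| * L := by gcongr
    linarith
  have s2' : |bb x n 2 0 0 σ δ α| ≤ C1 / c * (L * Q) := by
    rw [hb2]
    refine s2.trans ?_
    calc C1 * (L * R) ≤ C1 * (L * (Q / c)) := by gcongr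
      _ = _ := by ring
  have s4' : |bb x n 4 0 0 σ δ α| ≤ C1 / c * (L ^ 2 * Q) := by
    rw [hb4]
    refine s4.trans ?_
    calc C1 * (L ^ 2 * R) ≤ C1 * (L ^ 2 * (Q / c)) := by gcongr
      _ = _ := by ring
  have hCc : 0 ≤ C1 / c := by positivity
  have hP : 0 ≤ 2 * (D * C2) := by positivity
  have hP' : 0 ≤ 8 * (D ^ 4 * C2) := by positivity
  have hP0 : 0 ≤ (1 + D ^ 2) * (C1 / c) := by positivity
  have hDD : D ≤ 1 + D ^ 2 := (fun d : ℝ => by nlinarith [sq_nonneg (d - 1)] : ∀ d : ℝ, d ≤ 1 + d ^ 2) D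
  refine ⟨hQ, ?_, ?_, ?_, ?_⟩
  · have e : q1 x n 0 ![σ, δ, α] = -(σ * bb x n 2 0 0 σ δ α) := by simp [q1]
    rw [e, abs_neg, abs_mul, abs_of_pos hσ]
    calc σ * |bb x n 2 0 0 σ δ α| ≤ (1 + D ^ 2) * (C1 / c * (L * Q)) :=
          mul_le_mul (by linarith) s2' (abs_nonneg _) (by positivity)
      _ = (1 + D ^ 2) * (C1 / c) * (L * Q) := by ring
      _ ≤ _ := mul_le_mul_of_nonneg_right (by linarith) (by positivity)
  · have e : q2 x n 0 0 ![σ, δ, α] = -(bb x n 2 0 0 σ δ α - σ ^ 2 * bb x n 4 0 0 σ δ α) := by simp [q2]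
    rw [e, abs_neg]
    have hLL : L ≤ L ^ 2 := le_self_pow₀ hL (by norm_num)
    calc |bb x n 2 0 0 σ δ α - σ ^ 2 * bb x n 4 0 0 σ δ α|
        ≤ |bb x n 2 0 0 σ δ α| + |σ ^ 2 * bb x n 4 0 0 σ δ α| := abs_sub _ _
      _ ≤ C1 / c * (L ^ 2 * Q) + D ^ 2 * (C1 / c * (L ^ 2 * Q)) := by
          rw [abs_mul, abs_of_pos (by positivity : 0 < σ ^ 2)]
          have g1 : C1 / c * (L * Q) ≤ C1 / c * (L ^ 2 * Q) := by gcongr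
          have g2 : σ ^ 2 * |bb x n 4 0 0 σ δ α| ≤ D ^ 2 * (C1 / c * (L ^ 2 * Q)) := by gcongr
          linarith
      _ = (1 + D ^ 2) * (C1 / c) * (L ^ 2 * Q) := by ring
      _ ≤ _ := mul_le_mul_of_nonneg_right (by linarith) (by positivity)
  · intro j hj
    have h := q1_bound (x := x) (σ := σ) hD1 hL (by linarith) hK hE u0 u1 j hj
    refine h.trans ?_
    calc 2 * (ef n δ α * (D * L * (C2 * (Lg x * Wt α x))))
        = 2 * (D * C2) * (L * (E * (Lg x * Wt α x))) := by rw [hEdef]; ring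
      _ ≤ _ := mul_le_mul_of_nonneg_right (by linarith) (by positivity)
  · intro i j hij
    have h := q2_bound (x := x) hD1 hL (by linarith : |σ| ≤ D) (by linarith) (by linarith) (by linarith) hδ.ne'
      hK hE hE1 hB i j hij
    refine h.trans ?_
    calc 8 * (ef n δ α * (D ^ 4 * L ^ 2 * (C2 * (Lg x ^ 2 * Wt α x))))
        = 8 * (D ^ 4 * C2) * (L ^ 2 * (E * (Lg x ^ 2 * Wt α x))) := by rw [hEdef]; ring
      _ ≤ _ := mul_le_mul_of_nonneg_right (by linarith) (by positivity)

lemma Wt_scale {α s x z : ℝ} (hα0 : 0 < α) (hs : 0 < s) (h : 1 + |z| ≤ s * (1 + |x|)) :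
    Wt α x ≤ s ^ (α + 1) * Wt α z := by
  unfold Wt
  have h1 : (1 + |z|) ^ (α + 1) ≤ s ^ (α + 1) * (1 + |x|) ^ (α + 1) := by
    rw [← Real.mul_rpow hs.le (by positivity)]
    exact Real.rpow_le_rpow (by positivity) h (by linarith)
  rw [Real.rpow_neg (by positivity), Real.rpow_neg (by positivity), ← div_eq_mul_inv,
    le_div_iff₀ (by positivity), inv_mul_le_iff₀ (by positivity)]
  linarith

lemma psi_zero {ψ : ℝ → ℕ → ℝ → ℝ} (hψ : IsPsiFamily ψ) {α : ℝ} (hα : α ∈ Ioo (0:ℝ) 2) :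
    ∃ C > 0, ∀ z, ψ α 0 z ≤ C * Wt α z := by
  obtain ⟨c, hc, C, hC⟩ := hψ.unifBound {α} (by simpa using hα) isCompact_singleton 0
  have hα0 := hα.1
  refine ⟨(1 + |C|) * 4 ^ (α + 1) + 2 ^ (α + 1), by positivity, fun z => ?_⟩
  have hW := Wt_pos α z
  rcases le_total |z| 3 with h3 | h3
  · have hle : ψ α 0 z ≤ 1 + |C| := by
      rcases le_total |z| 1 with h1 | h1
      · rw [hψ.eq_one α hα 0 z h1]; linarith [abs_nonneg C]
      · have := (hC α rfl z h1 h3).2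
        linarith [le_abs_self C]
    have h4 : 1 ≤ 4 ^ (α + 1) * Wt α z := by
      have := Wt_scale (α := α) (s := 4) (x := 0) (z := z) hα0 (by norm_num) (by simp; linarith)
      simpa [Wt] using this
    have h5 : 0 ≤ (2:ℝ) ^ (α + 1) * Wt α z := by positivity
    have h6 : 1 + |C| ≤ (1 + |C|) * (4 ^ (α + 1) * Wt α z) := le_mul_of_one_le_right (by positivity) h4
    rw [add_mul]; linarith
  · rw [hψ.eq_tail α hα 0 z h3, pow_zero, Wt, Real.rpow_neg (by positivity)]
    have hz : 0 < |z| := by linarith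
    have h1 : (1 + |z|) ^ (α + 1) ≤ 2 ^ (α + 1) * |z| ^ (α + 1) := by
      rw [← Real.mul_rpow (by norm_num) hz.le]
      exact Real.rpow_le_rpow (by positivity) (by linarith) (by linarith)
    rw [← div_eq_mul_inv, div_le_div_iff₀ (by positivity) (by positivity), one_mul]
    have h2 : 0 ≤ (1 + |C|) * (4:ℝ) ^ (α + 1) * |z| ^ (α + 1) := by positivity
    rw [add_mul]; linarith

lemma psi_two {ψ : ℝ → ℕ → ℝ → ℝ} (hψ : IsPsiFamily ψ) {α : ℝ} (hα : α ∈ Ioo (0:ℝ) 2) :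
    ∃ C > 0, ∀ z, Lg z ^ 2 * Wt α z ≤ C * ψ α 2 z := by
  obtain ⟨c, hc, C, hC⟩ := hψ.unifBound {α} (by simpa using hα) isCompact_singleton 2
  have hα0 := hα.1
  refine ⟨16 * (1 + 1 / c) + 9, by positivity, fun z => ?_⟩
  have hW := Wt_pos α z
  have hp := hψ.pos α hα 2 z
  have hl := one_le_Lg z
  rcases le_total |z| 3 with h3 | h3
  · have hle : 1 ≤ (1 + 1 / c) * ψ α 2 z := by
      rcases le_total |z| 1 with h1 | h1
      · rw [hψ.eq_one α hα 2 z h1]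
        have : 0 < 1 / c := by positivity
        linarith
      · have := (hC α rfl z h1 h3).1
        have h2 : 1 ≤ 1 / c * ψ α 2 z := by
          rw [div_mul_eq_mul_div, le_div_iff₀ hc]; linarith
        rw [add_mul]; linarith
    have h4 : Lg z ≤ 4 := by
      unfold Lg
      have := Real.log_le_sub_one_of_pos (x := 1 + |z|) (by positivity)
      linarith
    have h5 : Lg z ^ 2 ≤ 16 := by nlinarith
    have h6 := Wt_le_one hα0 z
    have h7 : Lg z ^ 2 * Wt α z ≤ 16 * 1 := by gcongr
    rw [add_mul]; linarith
  · have hz : 0 < |z| := by linarith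
    rw [hψ.eq_tail α hα 2 z h3]
    have hlog1 : 1 ≤ Real.log |z| := by
      rw [Real.le_log_iff_exp_le hz]
      linarith [Real.exp_one_lt_three]
    have h1 : Lg z ≤ 3 * Real.log |z| := by
      unfold Lg
      have : Real.log (1 + |z|) ≤ Real.log (2 * |z|) := Real.log_le_log (by positivity) (by linarith)
      rw [Real.log_mul (by norm_num) hz.ne'] at this
      linarith [Real.log_two_lt_d9]
    have h2 : Wt α z ≤ 1 / |z| ^ (α + 1) := by
      unfold Wt
      rw [Real.rpow_neg (by positivity), ← one_div]
      gcongr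
      linarith
    calc Lg z ^ 2 * Wt α z ≤ (3 * Real.log |z|) ^ 2 * (1 / |z| ^ (α + 1)) := by gcongr
      _ = 9 * (Real.log |z| ^ 2 / |z| ^ (α + 1)) := by ring
      _ ≤ _ := by
        have : 0 ≤ 16 * (1 + 1 / c) := by positivity
        exact mul_le_mul_of_nonneg_right (by linarith) (by positivity)

lemma compare {ψ : ℝ → ℕ → ℝ → ℝ} (hψ : IsPsiFamily ψ) {σ α : ℝ} (hσ : 0 < σ) (hα : α ∈ Ioo (0:ℝ) 2) :
    ∃ C > 0, ∀ x E : ℝ, 0 < E →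
      gauss (x / σ) + E / σ ^ α * ψ α 0 (x / σ) ≤ C * (gs (σ ^ 2 / 2) x + E * Wt α x) ∧
      E * (Lg x ^ 2 * Wt α x) ≤ C * (E / σ ^ α * ψ α 2 (x / σ)) := by
  obtain ⟨C0, hC0, h0⟩ := psi_zero hψ hα
  obtain ⟨C2, hC2, h2⟩ := psi_two hψ hα
  have hα0 := hα.1
  have hpi := Real.pi_pos
  have ha : 0 < σ ^ 2 / 2 := by positivity
  set A := (Real.sqrt (2 * Real.pi))⁻¹ / (1 / 2 * Real.sqrt (Real.pi / (σ ^ 2 / 2))) with hA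
  have hA0 : 0 < A := by positivity
  set B := C0 * (1 + σ) ^ (α + 1) / σ ^ α with hB
  have hB0 : 0 < B := by positivity
  set G := (1 + Real.log (1 + σ)) ^ 2 * (1 + 1 / σ) ^ (α + 1) * C2 * σ ^ α with hG
  have hlσ : 0 ≤ Real.log (1 + σ) := Real.log_nonneg (by linarith)
  have hG0 : 0 < G := by positivity
  refine ⟨A + B + G, by positivity, fun x E hE => ?_⟩
  have hW := Wt_pos α x
  have hWz := Wt_pos α (x / σ)
  have hg := gs_pos ha x
  have hl := one_le_Lg x
  have hlz := one_le_Lg (x / σ)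
  have hz : |x / σ| = |x| / σ := by rw [abs_div, abs_of_pos hσ]
  have hxn := abs_nonneg x
  have hx1 : 1 + |x| ≤ (1 + σ) * (1 + |x / σ|) := by
    rw [hz]
    have e : (1 + σ) * (1 + |x| / σ) = 1 + |x| + σ + |x| / σ := by field_simp; ring
    have : 0 ≤ |x| / σ := by positivity
    linarith
  have hx2 : 1 + |x / σ| ≤ (1 + 1 / σ) * (1 + |x|) := by
    rw [hz]
    have e : (1 + 1 / σ) * (1 + |x|) = 1 + |x| / σ + |x| + 1 / σ := by field_simp; ring
    have : 0 ≤ 1 / σ := by positivity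
    linarith
  constructor
  · have g1 : gauss (x / σ) = A * gs (σ ^ 2 / 2) x := by
      have hne : (1 / 2 * Real.sqrt (Real.pi / (σ ^ 2 / 2))) ≠ 0 := by positivity
      rw [gs, ← mul_assoc (1 / 2 : ℝ), ← mul_assoc, hA, div_mul_cancel₀ _ hne, gauss]
      congr 2
      field_simp
      try ring
    have g2 : E / σ ^ α * ψ α 0 (x / σ) ≤ B * (E * Wt α x) := by
      have w1 := Wt_scale (α := α) hα0 (by linarith : 0 < 1 + σ) hx1
      calc E / σ ^ α * ψ α 0 (x / σ) ≤ E / σ ^ α * (C0 * ((1 + σ) ^ (α + 1) * Wt α x)) := by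
            have := (h0 (x / σ)).trans (mul_le_mul_of_nonneg_left w1 hC0.le)
            gcongr
        _ = _ := by rw [hB]; ring
    have p1 : 0 ≤ (B + G) * gs (σ ^ 2 / 2) x := by positivity
    have p2 : 0 ≤ (A + G) * (E * Wt α x) := by positivity
    rw [g1]
    linarith
  · have w2 := Wt_scale (α := α) hα0 (by positivity : 0 < 1 + 1 / σ) hx2
    have l2 : Lg x ≤ (1 + Real.log (1 + σ)) * Lg (x / σ) := by
      unfold Lg
      have h1 := Real.log_le_log (by positivity) hx1
      rw [Real.log_mul (by positivity) (by positivity)] at h1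
      have h3 : 0 ≤ Real.log (1 + |x / σ|) := Real.log_nonneg (by linarith [abs_nonneg (x / σ)])
      nlinarith
    have hψp := hψ.pos α hα 2 (x / σ)
    have hsp : σ ^ α ≠ 0 := by positivity
    calc E * (Lg x ^ 2 * Wt α x)
        ≤ E * (((1 + Real.log (1 + σ)) * Lg (x / σ)) ^ 2 * ((1 + 1 / σ) ^ (α + 1) * Wt α (x / σ))) := by
          gcongr
      _ = E * ((1 + Real.log (1 + σ)) ^ 2 * (1 + 1 / σ) ^ (α + 1)) * (Lg (x / σ) ^ 2 * Wt α (x / σ)) := by ring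
      _ ≤ E * ((1 + Real.log (1 + σ)) ^ 2 * (1 + 1 / σ) ^ (α + 1)) * (C2 * ψ α 2 (x / σ)) :=
          mul_le_mul_of_nonneg_left (h2 _) (by positivity)
      _ = G * (E / σ ^ α * ψ α 2 (x / σ)) := by rw [hG]; field_simp
      _ ≤ _ := mul_le_mul_of_nonneg_right (by linarith) (by positivity)

lemma quot_bound {q2 qi qj Q S V C : ℝ} (hQ : 0 < Q) (h2 : |q2| ≤ C * V)
    (h1 : |qi| * |qj| ≤ S * (V * Q)) :
    |q2 / Q - qi * qj / Q ^ 2| ≤ (C + S) * V / Q := by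
  refine (abs_sub _ _).trans ?_
  rw [abs_div, abs_div, abs_mul, abs_of_pos hQ, abs_of_pos (by positivity : 0 < Q ^ 2), add_mul, add_div]
  have a1 : |q2| / Q ≤ C * V / Q := by gcongr
  have a2 : |qi| * |qj| / Q ^ 2 ≤ S * V / Q := by
    rw [div_le_div_iff₀ (by positivity) hQ]
    nlinarith
  linarith

/-- bounds on the second-order partial derivatives of `ln p_{1/n}` at `θ₀`. -/
theorem statement15 (σ₀ δ₀ α₀ : ℝ) (hσ : 0 < σ₀) (hδ : 0 < δ₀) (hα : α₀ ∈ Set.Ioo (0 : ℝ) 2)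
    (ψ : ℝ → ℕ → ℝ → ℝ) (hψ : IsPsiFamily ψ) :
    ∃ C > (0 : ℝ), ∃ p > (0 : ℝ), ∃ N : ℕ, ∀ n ≥ N, ∀ y : ℝ,
      |pderiv 0 (fun θ' => pderiv 0 (fun θ'' => Real.log (pdens n θ'' y)) θ')
          ![σ₀, δ₀, α₀]| ≤ C * Real.log n ^ p ∧
      ∀ a b : Fin 3, ¬(a = 0 ∧ b = 0) →
        |pderiv a (fun θ' => pderiv b (fun θ'' => Real.log (pdens n θ'' y)) θ')
            ![σ₀, δ₀, α₀]| ≤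
          C * Real.log n ^ p *
            (wn n σ₀ δ₀ α₀ ^ α₀ * ψ α₀ 2 (Real.sqrt n * y / σ₀)) /
            (gauss (Real.sqrt n * y / σ₀)
              + wn n σ₀ δ₀ α₀ ^ α₀ * ψ α₀ 0 (Real.sqrt n * y / σ₀)) := by
  obtain ⟨hα0, hα2⟩ := hα
  obtain ⟨C, hC, c, hc, hev⟩ := main_bounds hσ hδ hα0 hα2
  obtain ⟨C3, hC3, hcmp⟩ := compare hψ hσ ⟨hα0, hα2⟩
  obtain ⟨N, hN⟩ := eventually_atTop.1 hev
  have hK : 0 < (C + C ^ 2 * (1 + 1 / c)) := by positivity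
  refine ⟨(C + C ^ 2) + (C + C ^ 2 * (1 + 1 / c)) * (C3 ^ 2 / c), by positivity, 2, by norm_num, N, ?_⟩
  intro n hn y
  obtain ⟨hn0, hL, hE, hx⟩ := hN n hn
  obtain ⟨hQl, h10, h20, h1, h2⟩ := hx (Real.sqrt n * y)
  obtain ⟨hT, hV⟩ := hcmp (Real.sqrt n * y) (ef n δ₀ α₀) hE
  have hw : wn n σ₀ δ₀ α₀ ^ α₀ = ef n δ₀ α₀ / σ₀ ^ α₀ := wn_rpow hn0 hσ hδ hα0
  rw [hw, Real.rpow_two]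
  have hgs : 0 < gs (σ₀ ^ 2 / 2) (Real.sqrt n * y) := gs_pos (by positivity) _
  have hW := Wt_pos α₀ (Real.sqrt n * y)
  have hLg := one_le_Lg (Real.sqrt n * y)
  have hψ0 := hψ.pos α₀ ⟨hα0, hα2⟩ 0 (Real.sqrt n * y / σ₀)
  have hψ2 := hψ.pos α₀ ⟨hα0, hα2⟩ 2 (Real.sqrt n * y / σ₀)
  have hga : 0 < gauss (Real.sqrt n * y / σ₀) := by unfold gauss; positivity
  have hσα : 0 < σ₀ ^ α₀ := Real.rpow_pos_of_pos hσ _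
  have hQ : 0 < bb (Real.sqrt n * y) n 0 0 0 σ₀ δ₀ α₀ := lt_of_lt_of_le (by positivity) hQl
  have key := fun i j => pdens_second hn0 y (θ := ![σ₀, δ₀, α₀])
    (show _ ∈ Uset from ⟨hσ, hδ, hα0, hα2⟩) hQ i j
  have hTp : 0 < gauss (Real.sqrt n * y / σ₀) + ef n δ₀ α₀ / σ₀ ^ α₀ * ψ α₀ 0 (Real.sqrt n * y / σ₀) := by
    positivity
  have hNp : 0 < ef n δ₀ α₀ / σ₀ ^ α₀ * ψ α₀ 2 (Real.sqrt n * y / σ₀) := by positivity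
  change ∀ i j, _ = q2 (Real.sqrt n * y) n i j ![σ₀, δ₀, α₀] / bb (Real.sqrt n * y) n 0 0 0 σ₀ δ₀ α₀ -
    q1 (Real.sqrt n * y) n i ![σ₀, δ₀, α₀] * q1 (Real.sqrt n * y) n j ![σ₀, δ₀, α₀]
      / bb (Real.sqrt n * y) n 0 0 0 σ₀ δ₀ α₀ ^ 2 at key
  simp only [key]
  clear key hx hN hev hcmp hw
  generalize gauss (Real.sqrt n * y / σ₀) + ef n δ₀ α₀ / σ₀ ^ α₀ * ψ α₀ 0 (Real.sqrt n * y / σ₀) = T at *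
  generalize ef n δ₀ α₀ / σ₀ ^ α₀ * ψ α₀ 2 (Real.sqrt n * y / σ₀) = M at *
  generalize bb (Real.sqrt n * y) n 0 0 0 σ₀ δ₀ α₀ = Q at *
  generalize gs (σ₀ ^ 2 / 2) (Real.sqrt n * y) = G at *
  generalize Wt α₀ (Real.sqrt n * y) = W at *
  generalize Lg (Real.sqrt n * y) = ℓ at *
  generalize ef n δ₀ α₀ = E at *
  generalize Real.log n = L at *
  have hL0 : 0 < L := by linarith
  have hl0 : 0 < ℓ := by linarith
  have hEW : E * W ≤ Q / c := by
    rw [le_div_iff₀ hc]; nlinarith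
  constructor
  · have hprod : |q1 (Real.sqrt n * y) n 0 ![σ₀, δ₀, α₀]| * |q1 (Real.sqrt n * y) n 0 ![σ₀, δ₀, α₀]|
        ≤ C ^ 2 * ((L ^ 2 * Q) * Q) := by
      calc _ ≤ (C * (L * Q)) * (C * (L * Q)) := by gcongr
        _ = _ := by ring
    refine (quot_bound hQ h20 hprod).trans ?_
    rw [div_le_iff₀ hQ]
    have : 0 ≤ (C + C ^ 2 * (1 + 1 / c)) * (C3 ^ 2 / c) * (L ^ 2 * Q) := by positivity
    nlinarith
  · intro a b hab
    have hmix : ∀ j : Fin 3, j ≠ 0 → |q1 (Real.sqrt n * y) n 0 ![σ₀, δ₀, α₀]| *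
        |q1 (Real.sqrt n * y) n j ![σ₀, δ₀, α₀]| ≤
        C ^ 2 * (1 + 1 / c) * ((L ^ 2 * (E * (ℓ ^ 2 * W))) * Q) := by
      intro j hj
      have hj1 := h1 j hj
      calc _ ≤ (C * (L * Q)) * (C * (L * (E * (ℓ * W)))) := by gcongr
        _ = C ^ 2 * 1 * ((L ^ 2 * (E * (ℓ * W))) * Q) := by ring
        _ ≤ _ := by
          gcongr
          · have : 0 < 1 / c := by positivity
            linarith
          · nlinarith
    have hprod : |q1 (Real.sqrt n * y) n a ![σ₀, δ₀, α₀]| * |q1 (Real.sqrt n * y) n b ![σ₀, δ₀, α₀]|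
        ≤ C ^ 2 * (1 + 1 / c) * ((L ^ 2 * (E * (ℓ ^ 2 * W))) * Q) := by
      by_cases ha : a = 0
      · subst ha
        exact hmix b fun hb => hab ⟨rfl, hb⟩
      · by_cases hb : b = 0
        · subst hb
          rw [mul_comm]
          exact hmix a ha
        · have ha1 := h1 a ha
          have hb1 := h1 b hb
          calc _ ≤ (C * (L * (E * (ℓ * W)))) * (C * (L * (E * (ℓ * W)))) := by gcongr
            _ = C ^ 2 * ((L ^ 2 * (E * (ℓ ^ 2 * W))) * (E * W)) := by ring
            _ ≤ C ^ 2 * ((L ^ 2 * (E * (ℓ ^ 2 * W))) * (Q / c)) := by gcongr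
            _ = C ^ 2 * (1 / c) * ((L ^ 2 * (E * (ℓ ^ 2 * W))) * Q) := by ring
            _ ≤ _ := by
              gcongr
              linarith
    refine (quot_bound hQ (h2 a b hab) hprod).trans ?_
    have hTQ : T * c ≤ C3 * Q := by
      calc T * c ≤ C3 * (G + E * W) * c := by gcongr
        _ = C3 * (c * (G + E * W)) := by ring
        _ ≤ _ := by gcongr
    rw [div_le_div_iff₀ hQ hTp]
    generalize C + C ^ 2 * (1 + 1 / c) = K at *
    calc K * (L ^ 2 * (E * (ℓ ^ 2 * W))) * T ≤ K * (L ^ 2 * (C3 * M)) * (C3 * Q / c) := by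
          gcongr
          rw [le_div_iff₀ hc]
          exact hTQ
      _ = (K * (C3 ^ 2 / c)) * (L ^ 2) * M * Q := by ring
      _ ≤ _ := by
          gcongr
          have : 0 < C + C ^ 2 := by positivity
          linarith

end LevyLAN
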